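/- arXiv:2001.05011 — 3 statements merged into one kernel-verified Lean document; each statement's English description precedes it below -/
import Mathlib

section
/- Fix n > 2 and k = 1. The number of permutations w ∈ S_n such that the Bruhat interval [σ_1, w] is a boolean lattice equals 4·F_{2n-4}, where F_i is the i-th Fibonacci number with F_0 = 0, F_1 = 1. -/
/-- The adjacent transposition `σ_{i+1} = (i+1, i+2)` (1-indexed), acting on `Fin n`;
here `i : Fin (n-1)` is the 0-indexed label, swapping positions `i` and `i+1`. -/
def sgen (n : ℕ) (i : Fin (n - 1)) : Equiv.Perm (Fin n) :=
  Equiv.swap ⟨i.1, by have := i.2; omega⟩ ⟨i.1 + 1, by have := i.2; omega⟩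

/-- `l` is a reduced word for `w`: its product is `w` and no shorter word of
adjacent transpositions has product `w`. -/
def IsReducedWord (n : ℕ) (w : Equiv.Perm (Fin n)) (l : List (Fin (n - 1))) : Prop :=
  (l.map (sgen n)).prod = w ∧
    ∀ l' : List (Fin (n - 1)), (l'.map (sgen n)).prod = w → l.length ≤ l'.length

/-- Bruhat order on `S_n` via the subword property: `v ≤ w` iff some reduced word
of `v` is a (not necessarily consecutive) subword of some reduced word of `w`. -/
def BruhatLe (n : ℕ) (v w : Equiv.Perm (Fin n)) : Prop :=
  ∃ lw lv : List (Fin (n - 1)),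
    IsReducedWord n w lw ∧ IsReducedWord n v lv ∧ lv.Sublist lw

/-- `w` contains the pattern `321`. -/
def Contains321 {n : ℕ} (w : Equiv.Perm (Fin n)) : Prop :=
  ∃ i j k : Fin n, i < j ∧ j < k ∧ w k < w j ∧ w j < w i

/-- `w` contains the pattern `3412`. -/
def Contains3412 {n : ℕ} (w : Equiv.Perm (Fin n)) : Prop :=
  ∃ i j k l : Fin n, i < j ∧ j < k ∧ k < l ∧ w k < w l ∧ w l < w i ∧ w i < w j

/-- `w` contains the pattern `231`. -/
def Contains231 {n : ℕ} (w : Equiv.Perm (Fin n)) : Prop :=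
  ∃ i j k : Fin n, i < j ∧ j < k ∧ w k < w i ∧ w i < w j

/-- `w` contains the pattern `312`. -/
def Contains312 {n : ℕ} (w : Equiv.Perm (Fin n)) : Prop :=
  ∃ i j k : Fin n, i < j ∧ j < k ∧ w j < w k ∧ w k < w i

/-- The Bruhat interval `[v, w]` in `S_n` is a boolean lattice: it is
order-isomorphic to the lattice of subsets of a finite set ordered by inclusion. -/
def IsBooleanBruhatInterval (n : ℕ) (v w : Equiv.Perm (Fin n)) : Prop :=
  ∃ (m : ℕ) (e : {u : Equiv.Perm (Fin n) // BruhatLe n v u ∧ BruhatLe n u w} ≃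
      Finset (Fin m)),
    ∀ a b : {u : Equiv.Perm (Fin n) // BruhatLe n v u ∧ BruhatLe n u w},
      BruhatLe n a.1 b.1 ↔ e a ⊆ e b

namespace BI

variable {n : ℕ}

/-- The adjacent transposition with a natural number label (identity if out of range). -/
def s (n i : ℕ) : Equiv.Perm (Fin n) :=
  if h : i + 1 < n then Equiv.swap ⟨i, by omega⟩ ⟨i + 1, h⟩ else 1

theorem sgen_eq (i : Fin (n - 1)) : sgen n i = s n i.1 := by
  have := i.2
  unfold sgen s
  rw [dif_pos (by omega)]

theorem s_val {i : ℕ} (h : i + 1 < n) (a : Fin n) :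
    (s n i a).val = if a.val = i then i + 1 else if a.val = i + 1 then i else a.val := by
  unfold s
  rw [dif_pos h, Equiv.swap_apply_def]
  simp only [Fin.ext_iff]
  split_ifs <;> simp

theorem s_mul_s (i : ℕ) : s n i * s n i = 1 := by
  unfold s
  split_ifs <;> simp

theorem s_inv (i : ℕ) : (s n i)⁻¹ = s n i := inv_eq_of_mul_eq_one_left (s_mul_s i)

theorem s_s (i : ℕ) (a : Fin n) : s n i (s n i a) = a := by
  have := s_mul_s (n := n) i
  exact congrArg (fun g => g a) this

theorem mul_s_s (w : Equiv.Perm (Fin n)) (i : ℕ) : w * s n i * s n i = w := by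
  rw [mul_assoc, s_mul_s, mul_one]

theorem s_s_mul (w : Equiv.Perm (Fin n)) (i : ℕ) : s n i * (s n i * w) = w := by
  rw [← mul_assoc, s_mul_s, one_mul]

theorem s_comm {i j : ℕ} (h : i + 2 ≤ j) (hj : j + 1 < n) : s n i * s n j = s n j * s n i := by
  ext a
  simp only [Equiv.Perm.mul_apply, s_val (show i + 1 < n by omega), s_val hj]
  split_ifs <;> omega

/-- ascent at position `i`. -/
def Asc (w : Equiv.Perm (Fin n)) (i : ℕ) : Prop :=
  ∃ h : i + 1 < n, w ⟨i, by omega⟩ < w ⟨i + 1, h⟩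

theorem s_left {i : ℕ} (h : i + 1 < n) : s n i ⟨i, by omega⟩ = ⟨i + 1, h⟩ := by
  ext; simp [s_val h]

theorem s_right {i : ℕ} (h : i + 1 < n) : s n i ⟨i + 1, h⟩ = ⟨i, by omega⟩ := by
  ext; simp [s_val h]

theorem asc_mul_s {w : Equiv.Perm (Fin n)} {i : ℕ} (h : i + 1 < n) (hw : ¬ Asc w i) :
    Asc (w * s n i) i := by
  refine ⟨h, ?_⟩
  simp only [Equiv.Perm.mul_apply, s_left h, s_right h]
  by_contra hc
  apply hw
  refine ⟨h, lt_of_le_of_ne (not_lt.mp hc) ?_⟩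
  intro he
  have := w.injective he
  simp at this

theorem not_asc_mul_s {w : Equiv.Perm (Fin n)} {i : ℕ} (hw : Asc w i) :
    ¬ Asc (w * s n i) i := by
  rintro ⟨h, h2⟩
  obtain ⟨h, h1⟩ := hw
  simp only [Equiv.Perm.mul_apply, s_left h, s_right h] at h2
  exact lt_asymm h1 h2

/-- inversion set -/
def Inv (w : Equiv.Perm (Fin n)) : Finset (Fin n × Fin n) :=
  Finset.univ.filter fun p => p.1 < p.2 ∧ w p.2 < w p.1

def inv (w : Equiv.Perm (Fin n)) : ℕ := (Inv w).card

theorem mem_Inv {w : Equiv.Perm (Fin n)} {p : Fin n × Fin n} :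
    p ∈ Inv w ↔ p.1 < p.2 ∧ w p.2 < w p.1 := by
  unfold Inv
  rw [Finset.mem_filter]
  simp

theorem inv_mul_s {w : Equiv.Perm (Fin n)} {i : ℕ} (hw : Asc w i) :
    inv (w * s n i) = inv w + 1 := by
  obtain ⟨h, hlt⟩ := hw
  have key : Inv (w * s n i) = insert ((⟨i, by omega⟩ : Fin n), (⟨i + 1, h⟩ : Fin n))
      ((Inv w).map (Equiv.prodCongr (s n i) (s n i)).toEmbedding) := by
    ext ⟨a, b⟩
    rw [Finset.mem_insert, Finset.mem_map_equiv, mem_Inv, mem_Inv]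
    simp only [ Equiv.prodCongr_symm,
      Equiv.prodCongr_apply, Prod.map, Equiv.Perm.mul_apply, Prod.mk.injEq]
    rw [show Equiv.symm (s n i) = s n i from s_inv i]
    by_cases hab : a.val = i ∧ b.val = i + 1
    · have ea : a = ⟨i, by omega⟩ := Fin.ext hab.1
      have eb : b = ⟨i + 1, h⟩ := Fin.ext hab.2
      rw [eb, ea]
      simp [s_left h, s_right h, hlt]
    · by_cases hba : a.val = i + 1 ∧ b.val = i
      · have ea : a = ⟨i + 1, h⟩ := Fin.ext hba.1
        have eb : b = ⟨i, by omega⟩ := Fin.ext hba.2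
        rw [ea, eb]
        simp [s_left h, s_right h, hlt.le]
      · have : a < b ↔ s n i a < s n i b := by
          rw [Fin.lt_def, Fin.lt_def, s_val h, s_val h]
          split_ifs <;> omega
        rw [this]
        constructor
        · exact fun h => Or.inr h
        · rintro (⟨rfl, rfl⟩ | h)
          · simp at hab
          · exact h
  unfold inv
  rw [key, Finset.card_insert_of_notMem, Finset.card_map]
  rw [Finset.mem_map_equiv, mem_Inv]
  simp only [ Equiv.prodCongr_symm,
      Equiv.prodCongr_apply, Prod.map]
  rw [show Equiv.symm (s n i) = s n i from s_inv i, s_left h, s_right h]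
  simp

theorem inv_mul_s' {w : Equiv.Perm (Fin n)} {i : ℕ} (h : i + 1 < n) (hw : ¬ Asc w i) :
    inv w = inv (w * s n i) + 1 := by
  have := inv_mul_s (asc_mul_s h hw)
  rwa [mul_s_s] at this

theorem inv_one : inv (1 : Equiv.Perm (Fin n)) = 0 := by
  unfold inv Inv
  rw [Finset.card_eq_zero, Finset.filter_eq_empty_iff]
  rintro ⟨a, b⟩ _ ⟨h1, h2⟩
  exact lt_asymm h1 h2

theorem eq_one_of_le {v : Equiv.Perm (Fin n)} (h : ∀ a, v a ≤ a) : v = 1 := by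
  have : ∀ k : ℕ, ∀ a : Fin n, a.val = k → v a = a := by
    intro k
    induction k using Nat.strong_induction_on with
    | _ k ih =>
      intro a ha
      by_contra hne
      have hlt : v a < a := lt_of_le_of_ne (h a) hne
      have := ih (v a).val (by rw [← ha]; exact hlt) (v a) rfl
      exact hne (v.injective this)
  ext a
  rw [this a.val a rfl]; rfl

/-- product of a word -/
def wp (l : List (Fin (n - 1))) : Equiv.Perm (Fin n) := (l.map (sgen n)).prod

theorem wp_append (l l' : List (Fin (n - 1))) : wp (l ++ l') = wp l * wp l' := by
  simp [wp]

theorem wp_cons (i : Fin (n - 1)) (l : List (Fin (n - 1))) : wp (i :: l) = s n i * wp l := by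
  simp [wp, sgen_eq]

theorem wp_nil : wp ([] : List (Fin (n - 1))) = 1 := by simp [wp]

theorem wp_concat (l : List (Fin (n - 1))) (i : Fin (n - 1)) : wp (l ++ [i]) = wp l * s n i := by
  rw [wp_append, wp_cons, wp_nil, mul_one]

theorem inv_mul_s_le (w : Equiv.Perm (Fin n)) {i : ℕ} (h : i + 1 < n) :
    inv (w * s n i) ≤ inv w + 1 := by
  by_cases hw : Asc w i
  · exact (inv_mul_s hw).le
  · have := inv_mul_s' h hw
    omega

theorem inv_wp_le (l : List (Fin (n - 1))) : inv (wp l) ≤ l.length := by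
  induction l using List.reverseRecOn with
  | nil => simp [wp_nil, inv_one]
  | append_singleton l i ih =>
    rw [wp_concat]
    have := inv_mul_s_le (wp l) (i := i) (by have := i.2; omega)
    simp; omega

theorem exists_word (w : Equiv.Perm (Fin n)) : ∃ l, wp l = w ∧ l.length = inv w := by
  induction hk : inv w generalizing w with
  | zero =>
    refine ⟨[], ?_, rfl⟩
    rw [wp_nil]
    have hasc : ∀ i, i + 1 < n → Asc w i := by
      intro i hi
      by_contra hc
      have := inv_mul_s' hi hc
      omega
    have hge : ∀ a : ℕ, ∀ h : a < n, a ≤ (w ⟨a, h⟩).val := by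
      intro a
      induction a with
      | zero => simp
      | succ a ih =>
        intro h
        obtain ⟨_, h2⟩ := hasc a h
        have := ih (by omega)
        rw [Fin.lt_def] at h2
        omega
    have : w⁻¹ = 1 := by
      apply eq_one_of_le
      intro a
      have := hge (w⁻¹ a).val (w⁻¹ a).2
      simpa using this
    rw [← inv_inv w, this, _root_.inv_one]
  | succ k ih =>
    have : ∃ i, ∃ _ : i + 1 < n, ¬ Asc w i := by
      by_contra hc
      push Not at hc
      have hsm : ∀ d a : ℕ, ∀ h : a + (d + 1) < n, w ⟨a, by omega⟩ < w ⟨a + (d + 1), h⟩ := by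
        intro d
        induction d with
        | zero => intro a h; exact (hc a h).2
        | succ d ihd =>
          intro a h
          exact (ihd a (by omega)).trans (hc (a + (d + 1)) h).2
      have : inv w = 0 := by
        unfold inv Inv
        rw [Finset.card_eq_zero, Finset.filter_eq_empty_iff]
        rintro ⟨a, b⟩ _ ⟨h1, h2⟩
        simp only [Fin.lt_def] at h1
        have := hsm (b.val - a.val - 1) a.val (by omega)
        have e : (⟨a.val + (b.val - a.val - 1 + 1), by omega⟩ : Fin n) = b := by
          ext; simp; omega
        rw [e] at this
        exact lt_asymm this h2
      omega
    obtain ⟨i, hi, hw⟩ := this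
    have h1 := inv_mul_s' hi hw
    obtain ⟨l, hl1, hl2⟩ := ih (w * s n i) (by omega)
    refine ⟨l ++ [⟨i, by omega⟩], ?_, by simp [hl2]⟩
    rw [wp_concat, hl1, mul_s_s]

theorem red_iff (w : Equiv.Perm (Fin n)) (l : List (Fin (n - 1))) :
    IsReducedWord n w l ↔ wp l = w ∧ l.length = inv w := by
  constructor
  · rintro ⟨h1, h2⟩
    refine ⟨h1, le_antisymm ?_ ?_⟩
    · obtain ⟨l', h3, h4⟩ := exists_word w
      rw [← h4]; exact h2 l' h3
    · have := inv_wp_le l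
      rwa [show wp l = w from h1] at this
  · rintro ⟨h1, h2⟩
    refine ⟨h1, fun l' hl' => ?_⟩
    have := inv_wp_le l'
    rw [show wp l' = w from hl'] at this
    omega

/-- `l` is reduced. -/
def Red (l : List (Fin (n - 1))) : Prop := l.length = inv (wp l)

theorem red_concat {l : List (Fin (n - 1))} {i : Fin (n - 1)} :
    Red (l ++ [i]) ↔ Red l ∧ Asc (wp l) i := by
  have hi : i.1 + 1 < n := by have := i.2; omega
  have h0 := inv_wp_le l
  unfold Red
  rw [wp_concat]
  simp only [List.length_append, List.length_singleton]
  by_cases hw : Asc (wp l) i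
  · have := inv_mul_s hw
    simp only [hw, and_true, this]
    omega
  · have := inv_mul_s' hi hw
    simp only [hw, and_false, iff_false]
    omega

theorem red_append_left {l l' : List (Fin (n - 1))} (h : Red (l ++ l')) : Red l := by
  induction l' using List.reverseRecOn with
  | nil => simpa using h
  | append_singleton l' i ih =>
    rw [← List.append_assoc, red_concat] at h
    exact ih h.1

theorem wp_reverse (l : List (Fin (n - 1))) : wp l.reverse = (wp l)⁻¹ := by
  induction l with
  | nil => simp [wp_nil]
  | cons i l ih => rw [List.reverse_cons, wp_concat, wp_cons, ih, mul_inv_rev, s_inv]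

theorem inv_inv_le (w : Equiv.Perm (Fin n)) : inv w⁻¹ ≤ inv w := by
  obtain ⟨l, h1, h2⟩ := exists_word w
  have := inv_wp_le l.reverse
  rw [wp_reverse, h1, List.length_reverse, h2] at this
  exact this

theorem inv_inv_eq (w : Equiv.Perm (Fin n)) : inv w⁻¹ = inv w := by
  apply le_antisymm (inv_inv_le w)
  have := inv_inv_le w⁻¹
  rwa [inv_inv] at this

theorem red_reverse {l : List (Fin (n - 1))} : Red l.reverse ↔ Red l := by
  unfold Red
  rw [wp_reverse, inv_inv_eq, List.length_reverse]

theorem red_append_right {l l' : List (Fin (n - 1))} (h : Red (l ++ l')) : Red l' := by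
  rw [← red_reverse, List.reverse_append] at h
  exact red_reverse.1 (red_append_left h)

/-- rank function -/
def r (w : Equiv.Perm (Fin n)) (i j : ℕ) : ℕ :=
  (Finset.univ.filter fun a : Fin n => a.val < i ∧ j ≤ (w a).val).card

theorem r_succ (w : Equiv.Perm (Fin n)) {i : ℕ} (j : ℕ) (h : i < n) :
    r w (i + 1) j = r w i j + if j ≤ (w ⟨i, h⟩).val then 1 else 0 := by
  unfold r
  split_ifs with hj
  · rw [← Finset.card_insert_of_notMem (a := (⟨i, h⟩ : Fin n)) (by simp)]
    congr 1
    ext a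
    simp only [Finset.mem_filter, Finset.mem_univ, true_and, Finset.mem_insert]
    by_cases ha : a = ⟨i, h⟩
    · subst ha; simp [hj]
    · have : a.val ≠ i := fun hh => ha (Fin.ext hh)
      simp only [ha, false_or]
      constructor <;> rintro ⟨h1, h2⟩ <;> exact ⟨by omega, h2⟩
  · rw [add_zero]
    congr 1
    ext a
    simp only [Finset.mem_filter, Finset.mem_univ, true_and]
    by_cases ha : a = ⟨i, h⟩
    · subst ha; simp [hj]
    · have : a.val ≠ i := fun hh => ha (Fin.ext hh)
      constructor <;> rintro ⟨h1, h2⟩ <;> exact ⟨by omega, h2⟩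

theorem r_mul_s (w : Equiv.Perm (Fin n)) {i i' : ℕ} (j : ℕ) (h : i + 1 < n) (hi : i' ≠ i + 1) :
    r (w * s n i) i' j = r w i' j := by
  unfold r
  apply Finset.card_equiv (s n i)
  intro a
  rw [Finset.mem_filter, Finset.mem_filter, Equiv.Perm.mul_apply, s_val h]
  simp only [Finset.mem_univ, true_and]
  apply and_congr_left
  intro _
  split_ifs <;> omega

def RLe (v w : Equiv.Perm (Fin n)) : Prop := ∀ i j, r v i j ≤ r w i j

theorem RLe.refl (v : Equiv.Perm (Fin n)) : RLe v v := fun _ _ => le_rfl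

theorem RLe.trans {u v w : Equiv.Perm (Fin n)} (h : RLe u v) (h' : RLe v w) : RLe u w :=
  fun i j => (h i j).trans (h' i j)

theorem le_La {v w : Equiv.Perm (Fin n)} {i : ℕ} (hv : Asc v i) (hw : Asc w i)
    (hle : RLe v (w * s n i)) : RLe v w := by
  intro i' j
  obtain ⟨h, hv⟩ := hv
  obtain ⟨_, hw⟩ := hw
  by_cases hi : i' = i + 1
  · subst hi
    have h0 := hle i j
    have h2 := hle (i + 1 + 1) j
    rw [r_mul_s _ _ h (by omega)] at h0 h2
    rw [r_succ _ _ h, r_succ _ _ h, r_succ _ _ (show i < n by omega),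
      r_succ _ _ (show i < n by omega)] at h2
    rw [r_succ _ _ (show i < n by omega), r_succ _ _ (show i < n by omega)]
    rw [Fin.lt_def] at hv hw
    split_ifs at * <;> omega
  · have := hle i' j
    rwa [r_mul_s _ _ h hi] at this

theorem le_Ld {v : Equiv.Perm (Fin n)} {i : ℕ} (hv : Asc v i) : RLe v (v * s n i) := by
  intro i' j
  obtain ⟨h, hv⟩ := hv
  by_cases hi : i' = i + 1
  · subst hi
    rw [r_succ _ _ (show i < n by omega), r_succ _ _ (show i < n by omega),
      r_mul_s _ _ h (by omega)]
    simp only [Equiv.Perm.mul_apply, s_left h]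
    rw [Fin.lt_def] at hv
    split_ifs at * <;> omega
  · rw [r_mul_s _ _ h hi]

theorem le_Lc {v w : Equiv.Perm (Fin n)} {i : ℕ} (hv : Asc v i) (hw : Asc w i)
    (hle : RLe v w) : RLe (v * s n i) (w * s n i) := by
  intro i' j
  obtain ⟨h, hv⟩ := hv
  obtain ⟨_, hw⟩ := hw
  by_cases hi : i' = i + 1
  · subst hi
    have h0 := hle i j
    have h2 := hle (i + 1 + 1) j
    rw [r_succ _ _ h, r_succ _ _ h, r_succ _ _ (show i < n by omega),
      r_succ _ _ (show i < n by omega)] at h2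
    rw [r_succ _ _ (show i < n by omega), r_succ _ _ (show i < n by omega),
      r_mul_s _ _ h (by omega), r_mul_s _ _ h (by omega)]
    simp only [Equiv.Perm.mul_apply, s_left h]
    rw [Fin.lt_def] at hv hw
    split_ifs at * <;> omega
  · rw [r_mul_s _ _ h hi, r_mul_s _ _ h hi]
    exact hle i' j

theorem eq_one_of_RLe {v : Equiv.Perm (Fin n)} (h : RLe v 1) : v = 1 := by
  apply eq_one_of_le
  intro a
  by_contra hc
  have h1 := h (a.val + 1) (a.val + 1)
  have h2 : r (1 : Equiv.Perm (Fin n)) (a.val + 1) (a.val + 1) = 0 := by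
    unfold r
    rw [Finset.card_eq_zero, Finset.filter_eq_empty_iff]
    rintro b _ ⟨h1, h2⟩
    simp at h2
    omega
  have h3 : 0 < r v (a.val + 1) (a.val + 1) := by
    unfold r
    rw [Finset.card_pos]
    refine ⟨a, ?_⟩
    simp only [Finset.mem_filter, Finset.mem_univ, true_and]
    rw [not_le, Fin.lt_def] at hc
    omega
  omega

theorem subword {l : List (Fin (n - 1))} (hl : Red l) {v : Equiv.Perm (Fin n)}
    (h : RLe v (wp l)) : ∃ lv, lv.Sublist l ∧ wp lv = v ∧ Red lv := by
  induction l using List.reverseRecOn generalizing v with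
  | nil =>
    rw [wp_nil] at h
    refine ⟨[], List.Sublist.refl _, ?_, hl⟩
    rw [wp_nil, eq_one_of_RLe h]
  | append_singleton l i ih =>
    obtain ⟨h1, h2⟩ := red_concat.1 hl
    rw [wp_concat] at h
    have hi : i.1 + 1 < n := by have := i.2; omega
    by_cases hv : Asc v i
    · obtain ⟨lv, h3, h4⟩ := ih h1 (le_La hv h2 h)
      exact ⟨lv, h3.trans (List.sublist_append_left _ _), h4⟩
    · have hv' := asc_mul_s hi hv
      have h5 : RLe (v * s n i) v := by
        have := le_Ld hv'
        rwa [mul_s_s] at this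
      obtain ⟨lv, h3, h4, h6⟩ := ih h1 (le_La hv' h2 (h5.trans h))
      refine ⟨lv ++ [i], h3.append_right _, ?_, ?_⟩
      · rw [wp_concat, h4, mul_s_s]
      · rw [red_concat, h4]; exact ⟨h6, hv'⟩

theorem RLe_of_sublist {l lv : List (Fin (n - 1))} (hl : Red l) (hv : Red lv)
    (h : lv.Sublist l) : RLe (wp lv) (wp l) := by
  induction l using List.reverseRecOn generalizing lv with
  | nil =>
    rw [List.sublist_nil] at h
    subst h; exact RLe.refl _
  | append_singleton l i ih =>
    obtain ⟨h1, h2⟩ := red_concat.1 hl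
    rw [List.sublist_append_iff] at h
    obtain ⟨a, b, rfl, h3, h4⟩ := h
    rw [wp_concat]
    rcases List.sublist_singleton.1 h4 with rfl | rfl
    · rw [List.append_nil] at hv ⊢
      exact (ih h1 hv h3).trans (le_Ld h2)
    · obtain ⟨h5, h6⟩ := red_concat.1 hv
      rw [wp_concat]
      exact le_Lc h6 h2 (ih h1 h5 h3)

theorem bruhat_iff (v w : Equiv.Perm (Fin n)) : BruhatLe n v w ↔ RLe v w := by
  constructor
  · rintro ⟨lw, lv, h1, h2, h3⟩
    obtain ⟨rfl, h1⟩ := (red_iff _ _).1 h1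
    obtain ⟨rfl, h2⟩ := (red_iff _ _).1 h2
    exact RLe_of_sublist h1 h2 h3
  · intro h
    obtain ⟨lw, rfl, h2⟩ := exists_word w
    obtain ⟨lv, h3, rfl, h5⟩ := subword h2 h
    exact ⟨lw, lv, (red_iff _ _).2 ⟨rfl, h2⟩, (red_iff _ _).2 ⟨rfl, h5⟩, h3⟩

theorem RLe_inv {v w : Equiv.Perm (Fin n)} (h : RLe v w) : RLe v⁻¹ w⁻¹ := by
  obtain ⟨lw, rfl, h2⟩ := exists_word w
  obtain ⟨lv, h3, rfl, h5⟩ := subword h2 h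
  rw [← wp_reverse, ← wp_reverse]
  exact RLe_of_sublist (red_reverse.2 h2) (red_reverse.2 h5) (List.reverse_sublist.2 h3)

theorem RLe_inv_iff {v w : Equiv.Perm (Fin n)} : RLe v⁻¹ w⁻¹ ↔ RLe v w := by
  refine ⟨fun h => ?_, RLe_inv⟩
  have := RLe_inv h
  rwa [inv_inv, inv_inv] at this

/-- The interval from `s 0` to `w` is a cube. -/
def Cube (w : Equiv.Perm (Fin n)) : Prop :=
  ∃ (m : ℕ) (f : (Fin m → Bool) → Equiv.Perm (Fin n)),
    (∀ S T, RLe (f S) (f T) ↔ S ≤ T) ∧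
    ∀ z, (RLe (s n 0) z ∧ RLe z w) ↔ ∃ S, f S = z

theorem Cube.inv {w : Equiv.Perm (Fin n)} (h : Cube w) : Cube w⁻¹ := by
  obtain ⟨m, f, h1, h2⟩ := h
  refine ⟨m, fun S => (f S)⁻¹, fun S T => ?_, fun z => ?_⟩
  · rw [RLe_inv_iff, h1]
  · have := h2 z⁻¹
    rw [← RLe_inv_iff, s_inv, inv_inv, ← RLe_inv_iff (v := z⁻¹), inv_inv] at this
    rw [this]
    simp only [inv_eq_iff_eq_inv]

theorem asc_s_zero {i : ℕ} (hi : 1 ≤ i) (h : i + 1 < n) : Asc (s n 0) i := by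
  refine ⟨h, ?_⟩
  rw [Fin.lt_def, s_val (by omega), s_val (by omega)]
  dsimp only
  rw [if_neg (show ¬ i = 0 by omega), if_neg (show ¬ i + 1 = 0 by omega),
    if_neg (show ¬ i + 1 = 0 + 1 by omega)]
  split_ifs <;> omega

theorem Cube.step {w : Equiv.Perm (Fin n)} {i : ℕ} (hi : 1 ≤ i) (h : i + 1 < n)
    (hw : Cube w) (hn : ¬ RLe (s n 0 * s n i) w) : Cube (w * s n i) := by
  obtain ⟨m, f, h1, h2⟩ := hw
  have a0 := asc_s_zero hi h
  have hS : ∀ S, RLe (s n 0) (f S) ∧ RLe (f S) w := fun S => (h2 _).2 ⟨S, rfl⟩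
  have hdesc : ∀ z, ¬ Asc z i → RLe (s n 0) z → RLe (s n 0) (z * s n i) := by
    intro z hz hle
    apply le_La a0 (asc_mul_s h hz)
    rwa [mul_s_s]
  have hasc : ∀ z, RLe (s n 0) z → RLe z w → Asc z i := by
    intro z hz1 hz2
    by_contra hc
    have h3 := le_Lc a0 (asc_mul_s h hc) (hdesc z hc hz1)
    rw [mul_s_s] at h3
    exact hn (h3.trans hz2)
  have hno : ∀ z, RLe (s n 0) z → RLe z w → ¬ RLe (z * s n i) w := by
    intro z hz1 hz2 hc
    exact hn ((le_Lc a0 (hasc z hz1 hz2) hz1).trans hc)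
  have haS : ∀ S, Asc (f S) i := fun S => hasc _ (hS S).1 (hS S).2
  have hwa : Asc w i := by
    have := hS (fun _ => false)
    exact hasc w (this.1.trans this.2) (RLe.refl _)
  refine ⟨m + 1, fun S => f (Fin.tail S) * (if S 0 then s n i else 1), ?_, ?_⟩
  · intro S T
    have hle : S ≤ T ↔ S 0 ≤ T 0 ∧ Fin.tail S ≤ Fin.tail T := by
      rw [Pi.le_def, Fin.forall_fin_succ]; rfl
    rw [hle, ← h1]
    cases hS0 : S 0 <;> cases hT0 : T 0
    · simp [hS0, hT0]
    · simp only [hS0, hT0, Bool.false_eq_true, if_false, if_true, mul_one]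
      constructor
      · intro h; exact ⟨by decide, le_La (haS _) (haS _) h⟩
      · rintro ⟨_, h⟩; exact h.trans (le_Ld (haS _))
    · simp only [hS0, hT0, Bool.false_eq_true, if_false, if_true, mul_one]
      constructor
      · intro h; exact absurd (h.trans (hS _).2) (hno _ (hS _).1 (hS _).2)
      · rintro ⟨h, _⟩; exact absurd h (by decide)
    · simp only [hS0, hT0, if_true]
      constructor
      · intro h; exact ⟨le_rfl, le_La (haS _) (haS _) ((le_Ld (haS _)).trans h)⟩
      · rintro ⟨_, h⟩; exact le_Lc (haS _) (haS _) h
  · intro z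
    constructor
    · rintro ⟨hz1, hz2⟩
      by_cases hz : Asc z i
      · obtain ⟨S, rfl⟩ := (h2 z).1 ⟨hz1, le_La hz hwa hz2⟩
        exact ⟨Fin.cons false S, by simp⟩
      · have hz' := asc_mul_s h hz
        have h5 : RLe (z * s n i) z := by
          have := le_Ld hz'
          rwa [mul_s_s] at this
        obtain ⟨S, hS⟩ := (h2 (z * s n i)).1 ⟨hdesc z hz hz1, le_La hz' hwa (h5.trans hz2)⟩
        exact ⟨Fin.cons true S, by simp [hS, mul_s_s]⟩
    · rintro ⟨S, rfl⟩
      cases hS0 : S 0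
      · simp only [hS0, Bool.false_eq_true, if_false, mul_one]
        exact ⟨(hS _).1, (hS _).2.trans (le_Ld hwa)⟩
      · simp only [hS0, if_true]
        exact ⟨(hS _).1.trans (le_Ld (haS _)), le_Lc (haS _) hwa (hS _).2⟩

theorem inv_s {i : ℕ} (h : i + 1 < n) : BI.inv (s n i) = 1 := by
  have : Asc (1 : Equiv.Perm (Fin n)) i := ⟨h, by simp [Fin.lt_def]⟩
  have := inv_mul_s this
  rwa [one_mul, inv_one] at this

theorem s_injOn {i j : ℕ} (hi : i + 1 < n) (hj : j + 1 < n) (h : s n i = s n j) : i = j := by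
  have h1 := congrArg (fun g => (g ⟨i, by omega⟩ : Fin n).val) h
  simp only [s_val hi, s_val hj, if_true] at h1
  split_ifs at h1 <;> omega

theorem red_singleton (i : Fin (n - 1)) : Red [i] := by
  unfold Red
  rw [wp_cons, wp_nil, mul_one, inv_s (by have := i.2; omega)]
  rfl

/-- the only thing below `s i` containing `s i` -/
theorem mem_iff {l : List (Fin (n - 1))} (hl : Red l) (i : Fin (n - 1)) :
    RLe (s n i) (wp l) ↔ i ∈ l := by
  have hi : i.1 + 1 < n := by have := i.2; omega
  constructor
  · intro h
    obtain ⟨lv, h1, h2, h3⟩ := subword hl h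
    have h4 : lv.length = 1 := by rw [h3, h2, inv_s hi]
    obtain ⟨a, rfl⟩ := List.length_eq_one_iff.1 h4
    rw [wp_cons, wp_nil, mul_one] at h2
    have := s_injOn (by have := a.2; omega) hi h2
    obtain rfl : a = i := Fin.ext this
    exact List.singleton_sublist.1 h1
  · intro h
    have := RLe_of_sublist hl (red_singleton i) (List.singleton_sublist.2 h)
    rwa [wp_cons, wp_nil, mul_one] at this

theorem cube_s_zero (h : 1 < n) : Cube (s n 0) := by
  refine ⟨0, fun _ => s n 0, ?_, ?_⟩
  · intro S T
    have : S = T := Subsingleton.elim _ _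
    subst this
    simp [RLe.refl]
  · intro z
    have hr := red_singleton (n := n) ⟨0, by omega⟩
    have hw : wp [(⟨0, by omega⟩ : Fin (n - 1))] = s n 0 := by
      rw [wp_cons, wp_nil, mul_one]
    constructor
    · rintro ⟨h1, h2⟩
      rw [← hw] at h2
      obtain ⟨lv, h3, rfl, h5⟩ := subword hr h2
      rcases List.sublist_singleton.1 h3 with rfl | rfl
      · rw [wp_nil] at h1
        have h6 := eq_one_of_RLe h1
        have h7 := inv_s (n := n) (i := 0) (by omega)
        rw [h6, inv_one] at h7
        omega
      · exact ⟨fun _ => false, hw.symm⟩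
    · rintro ⟨_, rfl⟩
      exact ⟨RLe.refl _, RLe.refl _⟩

theorem boolean_of_cube {w : Equiv.Perm (Fin n)} (hw : Cube w) :
    IsBooleanBruhatInterval n (s n 0) w := by
  obtain ⟨m, f, h1, h2⟩ := hw
  let E : (Fin m → Bool) ≃ Finset (Fin m) :=
    { toFun := fun S => Finset.univ.filter fun i => S i = true
      invFun := fun A i => decide (i ∈ A)
      left_inv := fun S => by ext i; simp
      right_inv := fun A => by ext i; simp }
  have hE : ∀ S T, E S ⊆ E T ↔ S ≤ T := by
    intro S T
    simp only [E, Equiv.coe_fn_mk, Finset.subset_iff, Finset.mem_filter, Finset.mem_univ, true_and,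
      Pi.le_def]
    exact forall_congr' fun i => (Bool.le_iff_imp).symm
  let F : (Fin m → Bool) →
      {u : Equiv.Perm (Fin n) // BruhatLe n (s n 0) u ∧ BruhatLe n u w} :=
    fun S => ⟨f S, by rw [bruhat_iff, bruhat_iff]; exact (h2 _).2 ⟨S, rfl⟩⟩
  have hF : Function.Bijective F := by
    constructor
    · intro S T hST
      have hST : f S = f T := congrArg Subtype.val hST
      apply le_antisymm
      · rw [← h1, hST]; exact RLe.refl _
      · rw [← h1, hST]; exact RLe.refl _
    · rintro ⟨u, hu⟩
      have hu' := hu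
      rw [bruhat_iff, bruhat_iff] at hu'
      obtain ⟨S, rfl⟩ := (h2 _).1 hu'
      exact ⟨S, rfl⟩
  refine ⟨m, (Equiv.ofBijective F hF).symm.trans E, ?_⟩
  intro a b
  obtain ⟨S, rfl⟩ := hF.2 a
  obtain ⟨T, rfl⟩ := hF.2 b
  have e : ∀ S, (Equiv.ofBijective F hF).symm (F S) = S := fun S =>
    (Equiv.ofBijective F hF).symm_apply_apply S
  rw [Equiv.trans_apply, Equiv.trans_apply, e, e, hE, bruhat_iff]
  exact h1 S T

def extra (n : ℕ) : ℕ → Finset (Equiv.Perm (Fin n))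
  | 0 => {s n 1 * s n 0 * s n 1}
  | 1 => {s n 1 * s n 0 * s n 2 * s n 1}
  | _ => ∅

/-- The permutations with boolean interval which use only the first `k` generators. -/
def C (n : ℕ) : ℕ → Finset (Equiv.Perm (Fin n))
  | 0 => ∅
  | 1 => {s n 0}
  | (k + 2) => C n (k + 1) ∪ (C n (k + 1)).image (fun u => u * s n (k + 1)) ∪
      (C n (k + 1) \ C n k).image (fun u => s n (k + 1) * u) ∪ extra n k

theorem mem_C {k : ℕ} {u : Equiv.Perm (Fin n)} : u ∈ C n (k + 2) ↔
    u ∈ C n (k + 1) ∨ (∃ v ∈ C n (k + 1), v * s n (k + 1) = u) ∨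
    (∃ v ∈ C n (k + 1), v ∉ C n k ∧ s n (k + 1) * v = u) ∨ u ∈ extra n k := by
  rw [C]
  simp only [Finset.mem_union, Finset.mem_image, Finset.mem_sdiff, or_assoc, and_assoc]

theorem s_fix {i : ℕ} (h : i + 1 < n) {a : Fin n} (h1 : a.val ≠ i) (h2 : a.val ≠ i + 1) :
    s n i a = a := by
  ext; rw [s_val h, if_neg h1, if_neg h2]

theorem extra_fix {k : ℕ} {u : Equiv.Perm (Fin n)} (hk : k + 2 < n) (hu : u ∈ extra n k)
    (a : Fin n) (ha : k + 2 < a.val) : u a = a := by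
  match k, hu with
  | 0, hu =>
    simp only [extra, Finset.mem_singleton] at hu
    subst hu
    simp only [Equiv.Perm.mul_apply]
    rw [s_fix (i := 1) (a := a), s_fix (i := 0) (a := a), s_fix (i := 1) (a := a)] <;> omega
  | 1, hu =>
    simp only [extra, Finset.mem_singleton] at hu
    subst hu
    simp only [Equiv.Perm.mul_apply]
    rw [s_fix (i := 1) (a := a), s_fix (i := 2) (a := a), s_fix (i := 0) (a := a),
      s_fix (i := 1) (a := a)] <;> omega
  | (k + 2), hu => simp [extra] at hu

theorem extra_nofix {k : ℕ} {u : Equiv.Perm (Fin n)} (hk : k + 2 < n) (hu : u ∈ extra n k) :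
    (u ⟨k + 2, hk⟩).val < k + 1 := by
  match k, hu with
  | 0, hu =>
    simp only [extra, Finset.mem_singleton] at hu
    subst hu
    simp only [Equiv.Perm.mul_apply]
    rw [s_val (by omega), s_val (by omega), s_val (by omega)]
    simp
  | 1, hu =>
    simp only [extra, Finset.mem_singleton] at hu
    subst hu
    simp only [Equiv.Perm.mul_apply]
    rw [s_val (by omega), s_val (by omega), s_val (by omega), s_val (by omega)]
    simp
  | (k + 2), hu => simp [extra] at hu

theorem C_fix {k : ℕ} (hk : k < n) {u : Equiv.Perm (Fin n)} (hu : u ∈ C n k) (a : Fin n)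
    (ha : k < a.val) : u a = a := by
  induction k generalizing u with
  | zero => simp [C] at hu
  | succ k ih =>
    cases k with
    | zero =>
      simp only [C, Finset.mem_singleton] at hu
      subst hu
      exact s_fix (by omega) (by omega) (by omega)
    | succ k =>
      rcases mem_C.1 hu with h | ⟨v, hv, rfl⟩ | ⟨v, hv, _, rfl⟩ | h
      · exact ih (by omega) h (by omega)
      · rw [Equiv.Perm.mul_apply, s_fix (by omega) (by omega) (by omega)]
        exact ih (by omega) hv (by omega)
      · rw [Equiv.Perm.mul_apply, ih (by omega) hv (by omega)]
        exact s_fix (by omega) (by omega) (by omega)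
      · exact extra_fix hk h a ha

theorem C_nofix_r {k : ℕ} (hk : k + 1 < n) {v : Equiv.Perm (Fin n)} (hv : v ∈ C n k) :
    (v * s n k) ⟨k + 1, hk⟩ ≠ ⟨k + 1, hk⟩ := by
  rw [Equiv.Perm.mul_apply, s_right hk]
  intro h
  have h2 := C_fix (by omega) hv ⟨k + 1, hk⟩ (by simp)
  have := v.injective (h.trans h2.symm)
  simp at this

theorem C_val_l {k : ℕ} (hk : k + 1 < n) {v : Equiv.Perm (Fin n)} (hv : v ∈ C n k) :
    (s n k * v) ⟨k + 1, hk⟩ = ⟨k, by omega⟩ := by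
  rw [Equiv.Perm.mul_apply, C_fix (by omega) hv ⟨k + 1, hk⟩ (by simp), s_right hk]

theorem C_of_fix {k : ℕ} (hk : k + 1 < n) {u : Equiv.Perm (Fin n)} (hu : u ∈ C n (k + 1))
    (h : u ⟨k + 1, hk⟩ = ⟨k + 1, hk⟩) : u ∈ C n k := by
  cases k with
  | zero =>
    simp only [C, Finset.mem_singleton] at hu
    subst hu
    rw [s_right hk] at h
    simp at h
  | succ k =>
    rcases mem_C.1 hu with h' | ⟨v, hv, rfl⟩ | ⟨v, hv, _, rfl⟩ | h'
    · exact h'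
    · exact absurd h (C_nofix_r hk hv)
    · rw [C_val_l hk hv] at h
      simp at h
    · have := extra_nofix hk h'
      rw [h] at this
      simp only at this
      omega

theorem C_subset (k : ℕ) : C n k ⊆ C n (k + 1) := by
  cases k with
  | zero => simp [C]
  | succ k => intro u hu; exact mem_C.2 (Or.inl hu)

theorem C_comm {k : ℕ} (hk : k + 2 < n) {v : Equiv.Perm (Fin n)} (hv : v ∈ C n k) :
    s n (k + 1) * v = v * s n (k + 1) := by
  ext a
  have key : ∀ b : Fin n, k < b.val → v b = b := fun b => C_fix (by omega) hv b
  simp only [Equiv.Perm.mul_apply]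
  by_cases ha : k < a.val
  · rw [key a ha, key (s n (k + 1) a)]
    rw [s_val (by omega)]
    split_ifs <;> omega
  · rw [s_fix (i := k + 1) (a := a) (by omega) (by omega) (by omega)]
    have h2 : (v a).val ≤ k := by
      by_contra hc
      have := v.injective (key (v a) (by omega))
      rw [this] at hc
      omega
    rw [s_fix (by omega) (by omega) (by omega)]

theorem C_card_rec {k : ℕ} (hk : k + 2 < n) :
    (C n (k + 2)).card + (C n k).card = 3 * (C n (k + 1)).card + (extra n k).card := by
  have hsd : (C n (k + 1) \ C n k).card + (C n k).card = (C n (k + 1)).card :=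
    Finset.card_sdiff_add_card_eq_card (C_subset k)
  have hi1 : ((C n (k + 1)).image (fun u => u * s n (k + 1))).card = (C n (k + 1)).card :=
    Finset.card_image_of_injective _ (mul_left_injective _)
  have hi2 : ((C n (k + 1) \ C n k).image (fun u => s n (k + 1) * u)).card =
      (C n (k + 1) \ C n k).card :=
    Finset.card_image_of_injective _ (mul_right_injective _)
  have hfixC : ∀ u ∈ C n (k + 1), u ⟨k + 2, hk⟩ = ⟨k + 2, hk⟩ := fun u hu =>
    C_fix (by omega) hu _ (by simp)
  rw [C, Finset.card_union_of_disjoint, Finset.card_union_of_disjoint,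
    Finset.card_union_of_disjoint, hi1, hi2]
  · omega
  · rw [Finset.disjoint_left]
    intro u hu hu'
    obtain ⟨v, hv, rfl⟩ := Finset.mem_image.1 hu'
    exact C_nofix_r hk hv (hfixC _ hu)
  · rw [Finset.disjoint_left]
    intro u hu hu'
    obtain ⟨v, hv, rfl⟩ := Finset.mem_image.1 hu'
    rw [Finset.mem_sdiff] at hv
    have h1 := C_val_l hk hv.1
    rcases Finset.mem_union.1 hu with h | h
    · rw [hfixC _ h] at h1
      simp at h1
    · obtain ⟨u, hu2, he⟩ := Finset.mem_image.1 h
      rw [← he, Equiv.Perm.mul_apply, s_right hk] at h1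
      have h2 := C_of_fix (by omega) hu2 h1
      rw [← C_comm hk h2] at he
      have h3 := mul_left_cancel he
      exact hv.2 (h3 ▸ h2)
  · rw [Finset.disjoint_left]
    intro u hu hu'
    have h0 := extra_nofix hk hu'
    rcases Finset.mem_union.1 hu with h | h
    · rcases Finset.mem_union.1 h with h | h
      · rw [hfixC _ h] at h0
        simp only at h0
        omega
      · obtain ⟨v, hv, rfl⟩ := Finset.mem_image.1 h
        have hv3 := hfixC v hv
        have hvk : v = (v * s n (k + 1)) * s n (k + 1) := (mul_s_s v (k + 1)).symm
        generalize hz : v * s n (k + 1) = z at *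
        rw [hvk, Equiv.Perm.mul_apply, s_right hk] at hv3
        clear hvk h hz h0 hv hu
        match k, hu' with
        | 0, hu' =>
          simp only [extra, Finset.mem_singleton] at hu'
          subst hu'
          have := congrArg Fin.val hv3
          simp only [Equiv.Perm.mul_apply] at this
          rw [s_val (by omega), s_val (by omega), s_val (by omega)] at this
          simp at this
        | 1, hu' =>
          simp only [extra, Finset.mem_singleton] at hu'
          subst hu'
          have := congrArg Fin.val hv3
          simp only [Equiv.Perm.mul_apply] at this
          rw [s_val (by omega), s_val (by omega), s_val (by omega), s_val (by omega)] at this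
          simp at this
        | (k + 2), hu' => simp [extra] at hu'
    · obtain ⟨v, hv, rfl⟩ := Finset.mem_image.1 h
      rw [Finset.mem_sdiff] at hv
      rw [C_val_l hk hv.1] at h0
      simp at h0

theorem C_card (k : ℕ) (hk : k + 2 < n) : (C n (k + 2)).card = 4 * Nat.fib (2 * k + 2) ∧
    (C n (k + 1)).card = if k = 0 then 1 else 4 * Nat.fib (2 * k) := by
  induction k with
  | zero =>
    have := C_card_rec hk
    simp [C, extra] at this ⊢
    exact this
  | succ k ih =>
    obtain ⟨h1, h2⟩ := ih (by omega)
    have h3 := C_card_rec hk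
    rw [h2, h1] at h3
    refine ⟨?_, by rw [if_neg (by omega)]; exact h1⟩
    have e1 : Nat.fib (2 * (k + 1) + 2) = Nat.fib (2 * k + 2) + Nat.fib (2 * k + 3) :=
      Nat.fib_add_two (n := 2 * k + 2)
    have e2 : Nat.fib (2 * k + 3) = Nat.fib (2 * k + 1) + Nat.fib (2 * k + 2) :=
      Nat.fib_add_two (n := 2 * k + 1)
    have e3 : Nat.fib (2 * k + 2) = Nat.fib (2 * k) + Nat.fib (2 * k + 1) :=
      Nat.fib_add_two (n := 2 * k)
    cases k with
    | zero => simp [extra] at *; omega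
    | succ k => simp [extra] at h3; omega

theorem not_le_of_fix {k : ℕ} (hk1 : 1 ≤ k) (hk : k + 1 < n) {u : Equiv.Perm (Fin n)}
    (hu : ∀ a : Fin n, k < a.val → u a = a) : ¬ RLe (s n 0 * s n k) u := by
  intro h
  have h1 := h (k + 1) (k + 1)
  have h2 : r u (k + 1) (k + 1) = 0 := by
    unfold r
    rw [Finset.card_eq_zero, Finset.filter_eq_empty_iff]
    rintro b _ ⟨h1, h2⟩
    have := u.injective (hu (u b) (by omega))
    rw [this] at h2
    omega
  have h3 : 0 < r (s n 0 * s n k) (k + 1) (k + 1) := by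
    unfold r
    rw [Finset.card_pos]
    refine ⟨⟨k, by omega⟩, ?_⟩
    simp only [Finset.mem_filter, Finset.mem_univ, true_and]
    rw [Equiv.Perm.mul_apply, s_left hk, s_fix (by omega)]
    · simp
    · simp
    · simp; omega
  omega

theorem r_two_one (h : 1 < n) (w : Equiv.Perm (Fin n)) : r w 2 1 =
    (if 1 ≤ (w ⟨0, by omega⟩).val then 1 else 0) + (if 1 ≤ (w ⟨1, h⟩).val then 1 else 0) := by
  rw [r_succ w 1 h, r_succ w 1 (show 0 < n by omega)]
  simp [r]

theorem not_le_x1 (h : 2 < n) : ¬ RLe (s n 0 * s n 1) (s n 1 * s n 0) := by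
  intro hc
  have := hc 2 1
  rw [r_two_one (by omega), r_two_one (by omega)] at this
  simp only [Equiv.Perm.mul_apply, s_val (show 0 + 1 < n by omega),
    s_val (show 1 + 1 < n by omega)] at this
  simp at this

theorem not_le_x2 (h : 3 < n) : ¬ RLe (s n 0 * s n 1) (s n 1 * s n 0 * s n 2) := by
  intro hc
  have := hc 2 1
  rw [r_two_one (by omega), r_two_one (by omega)] at this
  simp only [Equiv.Perm.mul_apply, s_val (show 0 + 1 < n by omega),
    s_val (show 1 + 1 < n by omega), s_val (show 2 + 1 < n by omega)] at this
  simp at this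

theorem Cube.step_r {k : ℕ} (hk1 : 1 ≤ k) (hk : k + 1 < n) {u : Equiv.Perm (Fin n)}
    (hu : ∀ a : Fin n, k < a.val → u a = a) (hc : Cube u) : Cube (u * s n k) :=
  hc.step hk1 hk (not_le_of_fix hk1 hk hu)

theorem Cube.step_l {k : ℕ} (hk1 : 1 ≤ k) (hk : k + 1 < n) {u : Equiv.Perm (Fin n)}
    (hu : ∀ a : Fin n, k < a.val → u a = a) (hc : Cube u) : Cube (s n k * u) := by
  have := (Cube.step_r hk1 hk (u := u⁻¹)
    (fun a ha => by rw [Equiv.Perm.inv_eq_iff_eq]; exact (hu a ha).symm) hc.inv).inv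
  rwa [mul_inv_rev, inv_inv, s_inv] at this

theorem C_cube {k : ℕ} (hk : k < n) {u : Equiv.Perm (Fin n)} (hu : u ∈ C n k) : Cube u := by
  induction k generalizing u with
  | zero => simp [C] at hu
  | succ k ih =>
    cases k with
    | zero =>
      simp only [C, Finset.mem_singleton] at hu
      subst hu
      exact cube_s_zero (by omega)
    | succ k =>
      rcases mem_C.1 hu with h | ⟨v, hv, rfl⟩ | ⟨v, hv, _, rfl⟩ | h
      · exact ih (by omega) h
      · exact Cube.step_r (by omega) hk (fun a => C_fix (by omega) hv a) (ih (by omega) hv)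
      · exact Cube.step_l (by omega) hk (fun a => C_fix (by omega) hv a) (ih (by omega) hv)
      · have c10 : Cube (s n 1 * s n 0) := by
          apply Cube.step_l le_rfl (by omega) _ (cube_s_zero (by omega))
          intro a ha
          exact s_fix (by omega) (by omega) (by omega)
        match k, h with
        | 0, h =>
          simp only [extra, Finset.mem_singleton] at h
          subst h
          exact c10.step le_rfl (by omega) (not_le_x1 (by omega))
        | 1, h =>
          simp only [extra, Finset.mem_singleton] at h
          subst h
          refine Cube.step le_rfl (by omega) ?_ (not_le_x2 (by omega))
          apply Cube.step_r (by omega) (by omega) _ c10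
          intro a ha
          rw [Equiv.Perm.mul_apply, s_fix (i := 0) (a := a), s_fix (a := a)] <;> omega
        | (k + 2), h => simp [extra] at h

/-- product of a word in natural number letters -/
def np (n : ℕ) (l : List ℕ) : Equiv.Perm (Fin n) := (l.map (s n)).prod

theorem np_append (l l' : List ℕ) : np n (l ++ l') = np n l * np n l' := by simp [np]

theorem np_cons (i : ℕ) (l : List ℕ) : np n (i :: l) = s n i * np n l := by simp [np]

theorem np_nil : np n [] = 1 := by simp [np]

theorem wp_eq_np (l : List (Fin (n - 1))) : wp l = np n (l.map Fin.val) := by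
  induction l with
  | nil => simp [wp_nil, np_nil]
  | cons a l ih => rw [wp_cons, List.map_cons, np_cons, ih]

theorem comm_high {k : ℕ} (hk : k + 2 < n) {a : List ℕ} (ha : ∀ x ∈ a, x < k) :
    s n (k + 1) * np n a = np n a * s n (k + 1) := by
  induction a with
  | nil => simp [np_nil]
  | cons x a ih =>
    have hx : x < k := ha x (by simp)
    rw [np_cons, ← mul_assoc, ← s_comm (i := x) (j := k + 1) (by omega) (by omega), mul_assoc,
      ih (fun y hy => ha y (by simp [hy])), mul_assoc]

theorem comm_zero {a : List ℕ} (ha : ∀ x ∈ a, 2 ≤ x ∧ x + 1 < n) :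
    s n 0 * np n a = np n a * s n 0 := by
  induction a with
  | nil => simp [np_nil]
  | cons x a ih =>
    have hx := ha x (by simp)
    rw [np_cons, ← mul_assoc, s_comm (i := 0) (j := x) (by omega) (by omega), mul_assoc,
      ih (fun y hy => ha y (by simp [hy])), mul_assoc]

def Good (l : List ℕ) : Prop := l.count 0 = 1 ∧ (∀ i, 2 ≤ i → l.count i ≤ 1) ∧
  (l.count 1 ≤ 1 ∨ l.count 1 = 2 ∧ [1, 0, 1].Sublist l)

theorem length_two {l : List ℕ} (h : ∀ x ∈ l, x < 2) : l.length = l.count 0 + l.count 1 := by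
  induction l with
  | nil => simp
  | cons x l ih =>
    have hx := h x (by simp)
    have := ih (fun y hy => h y (by simp [hy]))
    interval_cases x <;> simp <;> omega

theorem eq_101 {l : List ℕ} (h : ∀ x ∈ l, x < 2) (h0 : l.count 0 = 1) (h1 : l.count 1 = 2)
    (hs : [1, 0, 1].Sublist l) : l = [1, 0, 1] := by
  refine (hs.eq_of_length ?_).symm
  rw [length_two h, h0, h1]; rfl

theorem good_C {k : ℕ} (hk : k < n) {l : List ℕ} (hg : Good l) (hl : ∀ x ∈ l, x < k) :
    np n l ∈ C n k := by
  induction k generalizing l with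
  | zero =>
    have : 0 ∈ l := List.count_pos_iff.1 (by rw [hg.1]; omega)
    exact absurd (hl 0 this) (by omega)
  | succ k ih =>
    cases k with
    | zero =>
      have h1 : l.count 1 = 0 := List.count_eq_zero.2 fun h => by have := hl 1 h; omega
      have h2 := length_two (l := l) (fun x hx => by have := hl x hx; omega)
      rw [hg.1, h1] at h2
      obtain ⟨a, rfl⟩ := List.length_eq_one_iff.1 h2
      have := hl a (by simp)
      obtain rfl : a = 0 := by omega
      simp [np, C]
    | succ k =>
      by_cases hj : k + 1 ∈ l
      · by_cases hc : l.count (k + 1) ≤ 1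
        · obtain ⟨a, b, rfl⟩ := List.append_of_mem hj
          simp only [List.count_append, List.count_cons_self] at hc
          have ha : k + 1 ∉ a := List.count_eq_zero.1 (by omega)
          have hb : k + 1 ∉ b := List.count_eq_zero.1 (by omega)
          have hla : ∀ x ∈ a, x < k + 1 := fun x hx => by
            have h1 := hl x (by simp [hx])
            have h2 : x ≠ k + 1 := fun h => ha (h ▸ hx)
            omega
          have hlb : ∀ x ∈ b, x < k + 1 := fun x hx => by
            have h1 := hl x (by simp [hx])
            have h2 : x ≠ k + 1 := fun h => hb (h ▸ hx)
            omega
          have hcount : ∀ i, i ≠ k + 1 → (a ++ (k + 1) :: b).count i = (a ++ b).count i := by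
            intro i hi
            rw [List.count_append, List.count_append, List.count_cons_of_ne (Ne.symm hi)]
          have hcj : (a ++ b).count (k + 1) = 0 := by
            rw [List.count_eq_zero]; simp [ha, hb]
          obtain ⟨g0, g2, g1⟩ := hg
          have hg' : Good (a ++ b) := by
            refine ⟨?_, ?_, ?_⟩
            · rw [← hcount 0 (by omega)]; exact g0
            · intro i hi
              by_cases h : i = k + 1
              · rw [h, hcj]; omega
              · rw [← hcount i h]; exact g2 i hi
            · by_cases h : 1 = k + 1
              · left; rw [h, hcj]; omega
              · rw [← hcount 1 h]
                rcases g1 with g1 | ⟨g1, g3⟩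
                · exact Or.inl g1
                · refine Or.inr ⟨g1, ?_⟩
                  have h4 := g3.filter (fun x => decide (x ≠ k + 1))
                  have e1 : List.filter (fun x => decide (x ≠ k + 1)) [1, 0, 1] = [1, 0, 1] := by
                    apply List.filter_eq_self.2
                    intro x hx
                    simp only [List.mem_cons, List.not_mem_nil, or_false] at hx
                    simp only [ne_eq, decide_not, Bool.not_eq_eq_eq_not, Bool.not_true,
                      decide_eq_false_iff_not]
                    omega
                  have e2 : List.filter (fun x => decide (x ≠ k + 1)) (a ++ (k + 1) :: b)
                      = a ++ b := by
                    rw [List.filter_append, List.filter_cons_of_neg (by simp),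
                      List.filter_eq_self.2, List.filter_eq_self.2]
                    · intro x hx; have := hlb x hx; simp; omega
                    · intro x hx; have := hla x hx; simp; omega
                  rwa [e1, e2] at h4
          have hlab : ∀ x ∈ a ++ b, x < k + 1 := by
            intro x hx
            rcases List.mem_append.1 hx with h | h
            · exact hla x h
            · exact hlb x h
          have hmem := ih (by omega) hg' hlab
          have hprod : np n (a ++ (k + 1) :: b) = np n a * s n (k + 1) * np n b := by
            rw [np_append, np_cons, mul_assoc]
          by_cases hka : k ∈ a
          · by_cases hkb : k ∈ b
            · have h1 := List.count_pos_iff.2 hka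
              have h2 := List.count_pos_iff.2 hkb
              have h3 := hcount k (by omega)
              have h4 : (a ++ b).count k = a.count k + b.count k := List.count_append
              have hk1 : k = 1 := by
                by_contra hne
                rcases Nat.lt_or_ge k 2 with h | h
                · obtain rfl : k = 0 := by omega
                  omega
                · have := g2 k h; omega
              subst hk1
              rcases hg'.2.2 with h | ⟨h, h'⟩
              · rw [List.count_append] at h; omega
              · have he := eq_101 hlab hg'.1 h h'
                have hx2 : np n (a ++ (1 + 1) :: b) = s n 1 * s n 0 * s n 2 * s n 1 := by
                  have hcm := s_comm (n := n) (i := 0) (j := 2) (by omega) (by omega)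
                  rcases a with _ | ⟨x, _ | ⟨y, _ | ⟨z, a⟩⟩⟩
                  · simp at hka
                  · simp only [List.cons_append, List.nil_append, List.cons.injEq] at he
                    obtain ⟨rfl, rfl⟩ := he
                    simp only [np, List.cons_append, List.nil_append, List.map_cons, List.map_nil,
                      List.prod_cons, List.prod_nil, mul_one, mul_assoc, Nat.reduceAdd]
                    rw [← mul_assoc (s n 2), ← hcm, mul_assoc]
                  · simp only [List.cons_append, List.nil_append, List.cons.injEq] at he
                    obtain ⟨rfl, rfl, rfl⟩ := he
                    simp only [np, List.cons_append, List.nil_append, List.map_cons, List.map_nil,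
                      List.prod_cons, List.prod_nil, mul_one, mul_assoc, Nat.reduceAdd]
                  · have hb0 : b = [] := by
                      have := congrArg List.length he
                      simp only [List.length_append, List.length_cons, List.length_nil] at this
                      exact List.eq_nil_of_length_eq_zero (by omega)
                    subst hb0
                    simp at hkb
                rw [hx2]
                exact mem_C.2 (Or.inr (Or.inr (Or.inr (by simp [extra]))))
            · have hb' : ∀ x ∈ b, x < k := fun x hx => by
                have h1 := hlb x hx
                have h2 : x ≠ k := fun h => hkb (h ▸ hx)
                omega
              rw [hprod, mul_assoc, comm_high hk hb', ← mul_assoc, ← np_append]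
              exact mem_C.2 (Or.inr (Or.inl ⟨_, hmem, rfl⟩))
          · have ha' : ∀ x ∈ a, x < k := fun x hx => by
              have h1 := hla x hx
              have h2 : x ≠ k := fun h => hka (h ▸ hx)
              omega
            rw [hprod, ← comm_high hk ha', mul_assoc, ← np_append]
            by_cases hm : np n (a ++ b) ∈ C n k
            · rw [C_comm hk hm]
              exact mem_C.2 (Or.inr (Or.inl ⟨_, hmem, rfl⟩))
            · exact mem_C.2 (Or.inr (Or.inr (Or.inl ⟨_, hmem, hm, rfl⟩)))
        · obtain ⟨g0, g2, g1⟩ := hg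
          have hk0 : k = 0 := by
            by_contra h
            exact hc (g2 _ (by omega))
          subst hk0
          rcases g1 with g1 | ⟨g1, g3⟩
          · exact absurd g1 hc
          · rw [eq_101 hl g0 g1 g3]
            refine mem_C.2 (Or.inr (Or.inr (Or.inr ?_)))
            simp [extra, np, mul_assoc]
      · refine mem_C.2 (Or.inl (ih (by omega) hg ?_))
        intro x hx
        have h1 := hl x hx
        have h2 : x ≠ k + 1 := fun h => hj (h ▸ hx)
        omega

theorem alt_sublist {a b : ℕ} (hab : a ≠ b) {L : List ℕ} (h1 : [a, b].Sublist L)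
    (h2 : [b, a].Sublist L) : [a, b, a].Sublist L ∨ [b, a, b].Sublist L := by
  induction L with
  | nil => simp at h1
  | cons x t ih =>
    by_cases hxa : x = a
    · subst hxa
      left
      apply List.Sublist.cons_cons
      cases h2 with
      | cons _ h => exact h
      | cons_cons _ h => exact absurd rfl hab
    · by_cases hxb : x = b
      · subst hxb
        right
        apply List.Sublist.cons_cons
        cases h1 with
        | cons _ h => exact h
        | cons_cons _ h => exact absurd rfl hab
      · have h1' : [a, b].Sublist t := by
          cases h1 with
          | cons _ h => exact h
          | cons_cons _ h => exact absurd rfl hxa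
        have h2' : [b, a].Sublist t := by
          cases h2 with
          | cons _ h => exact h
          | cons_cons _ h => exact absurd rfl hxb
        exact (ih h1' h2').imp (fun h => h.cons _) (fun h => h.cons _)

theorem nodup_erase {L : List ℕ} {c : ℕ} (h : L.length ≤ L.toFinset.card + 1)
    (hc : 2 ≤ L.count c) : (L.erase c).Nodup := by
  have hm : c ∈ L := List.count_pos_iff.1 (by omega)
  have hm' : c ∈ L.erase c := by
    apply List.count_pos_iff.1
    rw [List.count_erase_self]; omega
  have he : (L.erase c).toFinset = L.toFinset := by
    ext x
    rw [List.mem_toFinset, List.mem_toFinset]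
    by_cases hx : x = c
    · subst hx; simp [hm, hm']
    · exact List.mem_erase_of_ne hx
  have hlen := List.length_erase_of_mem hm
  have hp := List.length_pos_of_mem hm
  have hle := List.toFinset_card_le (L.erase c)
  rw [← List.dedup_eq_self]
  apply (List.dedup_sublist _).eq_of_length
  rw [← List.card_toFinset]
  rw [he] at hle ⊢
  omega

theorem count_le_one_of_nodup {L : List ℕ} (h : L.Nodup) (i : ℕ) : L.count i ≤ 1 :=
  List.nodup_iff_count_le_one.1 h i

theorem braid (h : 2 < n) : s n 0 * s n 1 * s n 0 = s n 1 * s n 0 * s n 1 := by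
  ext a
  simp only [Equiv.Perm.mul_apply, s_val (show 0 + 1 < n by omega), s_val (show 1 + 1 < n by omega)]
  by_cases h0 : a.val = 0
  · simp [h0]
  · by_cases h1 : a.val = 1
    · simp [h1]
    · by_cases h2 : a.val = 2
      · simp [h2]
      · simp [h0, h1, h2]

theorem np_mem_C (hn : 2 < n) {L : List ℕ} (hL : ∀ x ∈ L, x < n - 1) (h0 : 0 ∈ L)
    (h : L.Nodup ∨ (L.length ≤ L.toFinset.card + 1 ∧ [0, 1].Sublist L ∧ [1, 0].Sublist L)) :
    np n L ∈ C n (n - 1) := by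
  rcases h with h | ⟨hlen, h01, h10⟩
  · apply good_C (by omega) _ hL
    refine ⟨?_, fun i _ => count_le_one_of_nodup h i, Or.inl (count_le_one_of_nodup h 1)⟩
    have := count_le_one_of_nodup h 0
    have := List.count_pos_iff.2 h0
    omega
  · rcases alt_sublist (by omega) h01 h10 with h | h
    · have hc : 2 ≤ L.count 0 := by simpa using h.count_le 0
      have hnd := nodup_erase hlen hc
      have hcnt : ∀ i, (L.erase 0).count i ≤ 1 := count_le_one_of_nodup hnd
      have hc0 : L.count 0 ≤ 2 := by
        have := hcnt 0
        rw [List.count_erase_self] at this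
        omega
      have hci : ∀ i, i ≠ 0 → L.count i ≤ 1 := by
        intro i hi
        have := hcnt i
        rwa [List.count_erase_of_ne hi] at this
      obtain ⟨r1, r2, rfl, hr1, h⟩ := List.cons_sublist_iff.1 h
      obtain ⟨r2, r3, rfl, hr2, h⟩ := List.cons_sublist_iff.1 h
      have hr3 := List.singleton_sublist.1 h
      obtain ⟨p, q, rfl⟩ := List.append_of_mem hr1
      obtain ⟨p', r, rfl⟩ := List.append_of_mem hr2
      obtain ⟨p'', t, rfl⟩ := List.append_of_mem hr3
      have hc1 := hci 1 (by omega)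
      simp only [List.count_append, List.count_cons] at hc0 hci hc1
      simp at hc0 hc1
      have hq : ∀ x ∈ q ++ p', 2 ≤ x ∧ x + 1 < n := by
        intro x hx
        have h1 : x < n - 1 := hL x (by
          simp only [List.mem_append, List.mem_cons] at hx ⊢; tauto)
        have h2 := List.count_pos_iff.2 hx
        rw [List.count_append] at h2
        refine ⟨?_, by omega⟩
        by_contra hlt
        have : x = 0 ∨ x = 1 := by omega
        rcases this with rfl | rfl <;> omega
      have hr : ∀ x ∈ r ++ p'', 2 ≤ x ∧ x + 1 < n := by
        intro x hx
        have h1 : x < n - 1 := hL x (by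
          simp only [List.mem_append, List.mem_cons] at hx ⊢; tauto)
        have h2 := List.count_pos_iff.2 hx
        rw [List.count_append] at h2
        refine ⟨?_, by omega⟩
        by_contra hlt
        have : x = 0 ∨ x = 1 := by omega
        rcases this with rfl | rfl <;> omega
      have heq : np n ((p ++ 0 :: q) ++ ((p' ++ 1 :: r) ++ (p'' ++ 0 :: t))) =
          np n (p ++ ((q ++ p') ++ ([1, 0, 1] ++ ((r ++ p'') ++ t)))) := by
        have e1 := comm_zero hq
        have e2 := comm_zero hr
        have e3 : np n [1, 0, 1] = s n 0 * s n 1 * s n 0 := by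
          rw [braid hn]; simp [np, mul_assoc]
        have e4 : (p ++ 0 :: q) ++ ((p' ++ 1 :: r) ++ (p'' ++ 0 :: t)) =
          p ++ 0 :: ((q ++ p') ++ 1 :: ((r ++ p'') ++ 0 :: t)) := by simp
        rw [e4, np_append p, np_append p, np_cons, np_append (q ++ p'), np_append (q ++ p'),
          np_append [1, 0, 1], e3, np_cons, np_append (r ++ p''), np_append (r ++ p''), np_cons]
        generalize np n (q ++ p') = Q at *
        generalize np n (r ++ p'') = R at *
        have e5 : s n 0 * (Q * (s n 1 * (R * (s n 0 * np n t)))) =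
            (s n 0 * Q) * s n 1 * (R * s n 0) * np n t := by simp only [mul_assoc]
        rw [e5, e1, ← e2]
        simp only [mul_assoc]
      rw [heq]
      apply good_C (by omega)
      · refine ⟨?_, ?_, ?_⟩
        · simp only [List.count_append, List.count_cons]
          simp
          omega
        · intro i hi
          have := hci i (by omega)
          simp only [List.count_append, List.count_cons]
          rw [if_neg (by simp; omega), if_neg (by simp; omega)]
          rw [if_neg (by simp; omega), if_neg (by simp; omega)] at this
          simp only [List.count_nil]
          omega
        · right
          constructor
          · simp only [List.count_append, List.count_cons]
            simp
            omega
          · rw [← List.append_assoc p]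
            exact (List.sublist_append_left _ _).trans (List.sublist_append_right _ _)
      · intro x hx
        simp only [List.mem_append, List.mem_cons, List.not_mem_nil] at hx hL
        by_cases h0 : x = 0
        · omega
        · by_cases h1 : x = 1
          · omega
          · apply hL; tauto
    · have hc : 2 ≤ L.count 1 := by simpa using h.count_le 1
      have hnd := nodup_erase hlen hc
      have hcnt : ∀ i, (L.erase 1).count i ≤ 1 := count_le_one_of_nodup hnd
      have hci : ∀ i, i ≠ 1 → L.count i ≤ 1 := by
        intro i hi
        have := hcnt i
        rwa [List.count_erase_of_ne hi] at this
      apply good_C (by omega) _ hL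
      refine ⟨?_, fun i hi => hci i (by omega), Or.inr ⟨?_, h⟩⟩
      · have := hci 0 (by omega)
        have := List.count_pos_iff.2 h0
        omega
      · have := hcnt 1
        rw [List.count_erase_self] at this
        omega

theorem red_01 (h0 : 0 < n - 1) (h1 : 1 < n - 1) :
    Red [(⟨0, h0⟩ : Fin (n - 1)), (⟨1, h1⟩ : Fin (n - 1))] := by
  have := (red_concat (n := n) (l := [⟨0, h0⟩]) (i := ⟨1, h1⟩)).2
    ⟨red_singleton _, by
      rw [wp_cons, wp_nil, mul_one]
      exact asc_s_zero le_rfl (by omega)⟩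
  exact this

theorem s01_ne (hn : 2 < n) : s n 0 * s n 1 ≠ s n 1 * s n 0 := by
  intro h
  have := congrArg (fun g => (g ⟨0, by omega⟩ : Fin n).val) h
  simp only [Equiv.Perm.mul_apply, s_val (show 0 + 1 < n by omega),
    s_val (show 1 + 1 < n by omega)] at this
  simp at this

theorem sub_of_le {a b : Fin (n - 1)} (hab : a ≠ b) (hr : Red [a, b])
    (hne : s n a * s n b ≠ s n b * s n a)
    {l : List (Fin (n - 1))} (hl : Red l) (h : RLe (s n a * s n b) (wp l)) :
    [a, b].Sublist l := by
  have hw : wp [a, b] = s n a * s n b := by rw [wp_cons, wp_cons, wp_nil, mul_one]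
  obtain ⟨lv, h1, h2, h3⟩ := subword hl h
  have h4 : lv.length = 2 := by
    rw [h3, h2, ← hw, ← hr]; rfl
  have ma : a ∈ lv := by
    rw [← mem_iff h3, h2, ← hw, mem_iff hr]; simp
  have mb : b ∈ lv := by
    rw [← mem_iff h3, h2, ← hw, mem_iff hr]; simp
  obtain ⟨c, d, rfl⟩ := List.length_eq_two.1 h4
  simp only [List.mem_cons, List.not_mem_nil, or_false] at ma mb
  rcases ma with rfl | rfl
  · rcases mb with rfl | rfl
    · exact absurd rfl hab
    · exact h1
  · rcases mb with rfl | rfl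
    · rw [wp_cons, wp_cons, wp_nil, mul_one] at h2
      exact absurd h2.symm hne
    · exact absurd rfl hab

theorem C_of_boolean (hn : 2 < n) {w : Equiv.Perm (Fin n)}
    (h : IsBooleanBruhatInterval n (s n 0) w) : w ∈ C n (n - 1) := by
  obtain ⟨m, e, he⟩ := h
  have hs0 : ∀ a : {u : Equiv.Perm (Fin n) // BruhatLe n (s n 0) u ∧ BruhatLe n u w},
      RLe (s n 0) a.1 := fun a => (bruhat_iff _ _).1 a.2.1
  have hsw : ∀ a : {u : Equiv.Perm (Fin n) // BruhatLe n (s n 0) u ∧ BruhatLe n u w},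
      RLe a.1 w := fun a => (bruhat_iff _ _).1 a.2.2
  have hle : ∀ a b, RLe a.1 b.1 ↔ e a ⊆ e b := fun a b => by rw [← bruhat_iff]; exact he a b
  have hmk : ∀ u, RLe (s n 0) u → RLe u w → ∃ a : {u : Equiv.Perm (Fin n) //
      BruhatLe n (s n 0) u ∧ BruhatLe n u w}, a.1 = u := fun u h1 h2 =>
    ⟨⟨u, (bruhat_iff _ _).2 h1, (bruhat_iff _ _).2 h2⟩, rfl⟩
  have h0w : RLe (s n 0) w := (hs0 (e.symm ∅)).trans (hsw (e.symm ∅))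
  obtain ⟨l, rfl, hl⟩ := exists_word w
  change Red l at hl
  let z0 : Fin (n - 1) := ⟨0, by omega⟩
  let z1 : Fin (n - 1) := ⟨1, by omega⟩
  have hz0 : z0 ∈ l := (mem_iff hl z0).1 h0w
  -- lower bound for `m`
  have chain : ∀ N : ℕ, ∀ l' : List (Fin (n - 1)), l'.length = N + 1 → Red l' → z0 ∈ l' →
      RLe (wp l') (wp l) → ∃ a : {u : Equiv.Perm (Fin n) //
      BruhatLe n (s n 0) u ∧ BruhatLe n u (wp l)}, a.1 = wp l' ∧ N ≤ (e a).card := by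
    intro N
    induction N with
    | zero =>
      intro l' _ hr hz hlw
      obtain ⟨a, ha⟩ := hmk (wp l') ((mem_iff hr z0).2 hz) hlw
      exact ⟨a, ha, by omega⟩
    | succ N ih =>
      intro l' hlen hr hz hlw
      have : ∃ l'' : List (Fin (n - 1)), l''.Sublist l' ∧ l''.length = N + 1 ∧ Red l'' ∧
          z0 ∈ l'' := by
        obtain ⟨p, q, rfl⟩ := List.append_of_mem hz
        rcases p with _ | ⟨c, p⟩
        · rcases List.eq_nil_or_concat q with rfl | ⟨q', c, rfl⟩
          · simp at hlen
          · refine ⟨z0 :: q', ?_, by simpa using hlen, ?_, by simp⟩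
            · simp
            · have hr' : Red ((z0 :: q') ++ [c]) := by simpa using hr
              exact red_append_left hr'
        · refine ⟨p ++ z0 :: q, ?_, ?_, ?_, by simp⟩
          · simp
          · simp at hlen ⊢; omega
          · have hr' : Red ([c] ++ (p ++ z0 :: q)) := by simpa using hr
            exact red_append_right hr'
      obtain ⟨l'', h1, h2, h3, h4⟩ := this
      have h5 := RLe_of_sublist hr h3 h1
      obtain ⟨a, ha, hN⟩ := ih l'' h2 h3 h4 (h5.trans hlw)
      obtain ⟨b, hb⟩ := hmk (wp l') ((mem_iff hr z0).2 hz) hlw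
      refine ⟨b, hb, ?_⟩
      have hsub : e a ⊆ e b := by rw [← hle, ha, hb]; exact h5
      have hne : e a ≠ e b := by
        intro hab
        have : a = b := e.injective hab
        rw [this, hb] at ha
        have h6 : l'.length = l''.length := by rw [hr, h3, ha]
        omega
      have := Finset.card_lt_card (lt_of_le_of_ne hsub hne)
      omega
  have hlpos := List.length_pos_of_mem hz0
  have hm : l.length ≤ m + 1 := by
    obtain ⟨a, _, ha⟩ := chain (l.length - 1) l (by omega) hl hz0 (RLe.refl _)
    have := Finset.card_le_univ (e a)
    rw [Fintype.card_fin] at this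
    omega
  -- atoms
  have hbot : ∀ a, a.1 = s n 0 → e a = ∅ := by
    intro a ha
    have : e a ⊆ e (e.symm ∅) := by rw [← hle, ha]; exact hs0 _
    rw [Equiv.apply_symm_apply] at this
    exact Finset.subset_empty.1 this
  have hzne : ∀ c : Fin (n - 1), c ≠ z0 → 1 ≤ c.1 := by
    intro c hc
    by_contra hlt
    exact hc (Fin.ext (by simp only [z0]; omega))
  have atoms : ∀ j : Fin m, ∃ i ∈ l.toFinset.erase z0,
      (e.symm {j}).1 = s n 0 * s n i ∨ (e.symm {j}).1 = s n i * s n 0 := by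
    intro j
    obtain ⟨lu, hlu, hru⟩ := exists_word (e.symm {j}).1
    rw [← hlu] at hru
    change Red lu at hru
    have hz : z0 ∈ lu := by
      rw [← mem_iff hru, hlu]; exact hs0 _
    have hwu : RLe (wp lu) (wp l) := by rw [hlu]; exact hsw _
    have hnot : lu ≠ [z0] := by
      rintro rfl
      rw [wp_cons, wp_nil, mul_one] at hlu
      have := hbot _ hlu.symm
      rw [Equiv.apply_symm_apply] at this
      simp at this
    have : ∃ (c : Fin (n - 1)) (t : List (Fin (n - 1))), (t = [z0, c] ∨ t = [c, z0]) ∧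
        t.Sublist lu ∧ Red t := by
      obtain ⟨p, q, rfl⟩ := List.append_of_mem hz
      rcases List.eq_nil_or_concat p with rfl | ⟨p', c, rfl⟩
      · rcases q with _ | ⟨c, q⟩
        · exact absurd rfl hnot
        · refine ⟨c, [z0, c], Or.inl rfl, by simp, ?_⟩
          have hr' : Red ([z0, c] ++ q) := by simpa using hru
          exact red_append_left hr'
      · refine ⟨c, [c, z0], Or.inr rfl, ?_, ?_⟩
        · have : p'.concat c ++ z0 :: q = p' ++ ([c, z0] ++ q) := by simp
          rw [this]
          exact (List.sublist_append_left _ _).trans (List.sublist_append_right _ _)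
        · have hr' : Red (p' ++ ([c, z0] ++ q)) := by simpa using hru
          exact red_append_left (red_append_right hr')
    obtain ⟨c, t, ht, hts, htr⟩ := this
    have htl : t.length = 2 := by rcases ht with rfl | rfl <;> rfl
    have hzt : z0 ∈ t := by rcases ht with rfl | rfl <;> simp
    have hct : c ∈ t := by rcases ht with rfl | rfl <;> simp
    have htu := RLe_of_sublist hru htr hts
    obtain ⟨b, hb⟩ := hmk (wp t) ((mem_iff htr z0).2 hzt) (htu.trans hwu)
    have hbj : e b ⊆ {j} := by
      have : e b ⊆ e (e.symm {j}) := by rw [← hle, hb, ← hlu]; exact htu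
      rwa [Equiv.apply_symm_apply] at this
    obtain ⟨a0, ha0⟩ := hmk (s n 0) (RLe.refl _) h0w
    have hbne : e b ≠ ∅ := by
      intro hbe
      rw [← hbot a0 ha0] at hbe
      have := e.injective hbe
      rw [this, ha0] at hb
      have h2 : t.length = 1 := by rw [htr, ← hb, inv_s (by omega)]
      omega
    have hbeq : e b = {j} := by
      rcases Finset.subset_singleton_iff.1 hbj with h | h
      · exact absurd h hbne
      · exact h
    have hbs : e.symm {j} = b := by rw [← hbeq, Equiv.symm_apply_apply]
    rw [hbs, hb]
    refine ⟨c, ?_, ?_⟩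
    · rw [Finset.mem_erase, List.mem_toFinset]
      constructor
      · rintro rfl
        have : wp t = 1 := by
          rcases ht with rfl | rfl <;> rw [wp_cons, wp_cons, wp_nil, mul_one, s_mul_s]
        have h2 : t.length = 0 := by rw [htr, this, inv_one]
        omega
      · rw [← mem_iff hl]
        exact ((mem_iff htr c).2 hct).trans (htu.trans hwu)
    · rcases ht with rfl | rfl
      · left; rw [wp_cons, wp_cons, wp_nil, mul_one]
      · right; rw [wp_cons, wp_cons, wp_nil, mul_one]
  have hcomm : ∀ i : Fin (n - 1), i ≠ z0 → i ≠ z1 → s n 0 * s n i = s n i * s n 0 := by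
    intro i h0 h1
    have h2 := hzne i h0
    have h3 : i.1 ≠ 1 := fun h => h1 (Fin.ext h)
    have := i.2
    exact s_comm (by omega) (by omega)
  let U : Finset (Equiv.Perm (Fin n)) := Finset.univ.image fun j : Fin m => (e.symm {j}).1
  have hU : U.card = m := by
    rw [Finset.card_image_of_injective, Finset.card_univ, Fintype.card_fin]
    intro i j hij
    have := e.symm.injective (Subtype.ext hij)
    exact Finset.singleton_injective this
  have hUw : ∀ u ∈ U, RLe u (wp l) := by
    intro u hu
    obtain ⟨j, _, rfl⟩ := Finset.mem_image.1 hu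
    exact hsw _
  have hUa : ∀ u ∈ U, ∃ i ∈ l.toFinset.erase z0, u = s n 0 * s n i ∨ u = s n i * s n 0 := by
    intro u hu
    obtain ⟨j, _, rfl⟩ := Finset.mem_image.1 hu
    exact atoms j
  have hA : (l.toFinset.erase z0).card + 1 = l.toFinset.card :=
    Finset.card_erase_add_one (by simpa using hz0)
  have hfin : l.Nodup ∨ (l.length ≤ l.toFinset.card + 1 ∧ s n 0 * s n 1 ∈ U ∧
      s n 1 * s n 0 ∈ U) := by
    have hnd : m ≤ (l.toFinset.erase z0).card → l.Nodup := by
      intro hle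
      rw [← List.dedup_eq_self]
      apply (List.dedup_sublist _).eq_of_length
      have h1 := List.toFinset_card_le l
      rw [← List.card_toFinset]
      omega
    by_cases h01 : s n 0 * s n 1 ∈ U
    · by_cases h10 : s n 1 * s n 0 ∈ U
      · right
        refine ⟨?_, h01, h10⟩
        have hsub : U ⊆ insert (s n 0 * s n 1)
            ((l.toFinset.erase z0).image fun i : Fin (n - 1) => s n i * s n 0) := by
          intro u hu
          obtain ⟨i, hi, h | h⟩ := hUa u hu
          · by_cases hi1 : i = z1
            · subst hi1
              exact Finset.mem_insert.2 (Or.inl h)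
            · rw [hcomm i (Finset.mem_erase.1 hi).1 hi1] at h
              exact Finset.mem_insert_of_mem (Finset.mem_image.2 ⟨i, hi, h.symm⟩)
          · exact Finset.mem_insert_of_mem (Finset.mem_image.2 ⟨i, hi, h.symm⟩)
        have h1 := Finset.card_le_card hsub
        have h2 := Finset.card_insert_le (s n 0 * s n 1)
          ((l.toFinset.erase z0).image fun i : Fin (n - 1) => s n i * s n 0)
        have h3 : ((l.toFinset.erase z0).image fun i : Fin (n - 1) => s n i * s n 0).card ≤ _ :=
          Finset.card_image_le
        omega
      · left
        apply hnd
        have hsub : U ⊆ (l.toFinset.erase z0).image fun i : Fin (n - 1) => s n 0 * s n i := by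
          intro u hu
          obtain ⟨i, hi, h | h⟩ := hUa u hu
          · exact Finset.mem_image.2 ⟨i, hi, h.symm⟩
          · by_cases hi1 : i = z1
            · subst hi1
              exact absurd (h ▸ hu) h10
            · rw [← hcomm i (Finset.mem_erase.1 hi).1 hi1] at h
              exact Finset.mem_image.2 ⟨i, hi, h.symm⟩
        have h1 := Finset.card_le_card hsub
        have h3 : ((l.toFinset.erase z0).image fun i : Fin (n - 1) => s n 0 * s n i).card ≤ _ :=
          Finset.card_image_le
        omega
    · left
      apply hnd
      have hsub : U ⊆ (l.toFinset.erase z0).image fun i : Fin (n - 1) => s n i * s n 0 := by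
        intro u hu
        obtain ⟨i, hi, h | h⟩ := hUa u hu
        · by_cases hi1 : i = z1
          · subst hi1
            exact absurd (h ▸ hu) h01
          · rw [hcomm i (Finset.mem_erase.1 hi).1 hi1] at h
            exact Finset.mem_image.2 ⟨i, hi, h.symm⟩
        · exact Finset.mem_image.2 ⟨i, hi, h.symm⟩
      have h1 := Finset.card_le_card hsub
      have h3 : ((l.toFinset.erase z0).image fun i : Fin (n - 1) => s n i * s n 0).card ≤ _ :=
        Finset.card_image_le
      omega
  rw [wp_eq_np]
  apply np_mem_C hn
  · intro x hx
    obtain ⟨y, _, rfl⟩ := List.mem_map.1 hx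
    exact y.2
  · exact List.mem_map.2 ⟨z0, hz0, rfl⟩
  · rcases hfin with h | ⟨h1, h2, h3⟩
    · exact Or.inl (h.map Fin.val_injective)
    · refine Or.inr ⟨?_, ?_, ?_⟩
      · have e1 : (l.map Fin.val).toFinset = l.toFinset.image Fin.val := by
          ext x; simp
        rw [e1, Finset.card_image_of_injective _ Fin.val_injective, List.length_map]
        exact h1
      · have hz : z0 ≠ z1 := by simp [z0, z1]
        exact (sub_of_le hz (red_01 (by omega) (by omega)) (s01_ne hn) hl (hUw _ h2)).map Fin.val
      · have hz : z1 ≠ z0 := by simp [z0, z1]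
        exact (sub_of_le hz (red_reverse.2 (red_01 (by omega) (by omega))) (s01_ne hn).symm hl
          (hUw _ h3)).map Fin.val

theorem boolean_iff (hn : 2 < n) (w : Equiv.Perm (Fin n)) :
    IsBooleanBruhatInterval n (s n 0) w ↔ w ∈ C n (n - 1) :=
  ⟨C_of_boolean hn, fun h => boolean_of_cube (C_cube (by omega) h)⟩

end BI

/-- For `n > 2`, the number of `w ∈ S_n` such that the Bruhat interval `[σ_1, w]`
is a boolean lattice equals `4 F_{2n-4}`. -/
theorem card_boolean_intervals_over_sigma_one (n : ℕ) (hn : 2 < n) :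
    Nat.card {w : Equiv.Perm (Fin n) //
      IsBooleanBruhatInterval n (sgen n ⟨0, by omega⟩) w} = 4 * Nat.fib (2 * n - 4) := by
  have e0 : sgen n ⟨0, by omega⟩ = BI.s n 0 := BI.sgen_eq _
  have e1 : ∀ w : Equiv.Perm (Fin n), IsBooleanBruhatInterval n (sgen n ⟨0, by omega⟩) w ↔
      w ∈ BI.C n (n - 1) := fun w => by rw [e0]; exact BI.boolean_iff hn w
  rw [Nat.card_congr (Equiv.subtypeEquivRight e1), Nat.card_eq_fintype_card, Fintype.card_coe]
  obtain ⟨k, rfl⟩ : ∃ k, n = k + 3 := ⟨n - 3, by omega⟩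
  rw [show k + 3 - 1 = k + 2 by omega, (BI.C_card k (by omega)).1,
    show 2 * (k + 3) - 4 = 2 * k + 2 by omega]
end

section
/- Let w ∈ S_n and suppose some reduced word of w has the form a·σ_h·b·σ_{h+1}·c·σ_h·d·σ_k·e (with a,b,c,d,e possibly empty products of generators). Then the Bruhat interval [σ_k, w] is not a lattice. -/
namespace BruhatAux

/-- Product of a word. -/
def P (n : ℕ) (l : List (Fin (n - 1))) : Equiv.Perm (Fin n) := (l.map (sgen n)).prod

/-- A word is reduced. -/
def Red (n : ℕ) (l : List (Fin (n - 1))) : Prop :=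
  ∀ l', P n l' = P n l → l.length ≤ l'.length

variable {n : ℕ}

lemma P_nil : P n [] = 1 := rfl
lemma P_cons (i : Fin (n - 1)) (l) : P n (i :: l) = sgen n i * P n l := by simp [P]
lemma P_append (l l') : P n (l ++ l') = P n l * P n l' := by simp [P]

lemma red_iff (l : List (Fin (n - 1))) : IsReducedWord n (P n l) l ↔ Red n l := by
  simp [IsReducedWord, Red, P]

lemma Red.factor {a l b : List (Fin (n - 1))} (h : Red n (a ++ l ++ b)) : Red n l := by
  intro l' hl'
  have := h (a ++ l' ++ b) (by simp [P_append, hl'])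
  simp at this
  omega

/-- Inversions. -/
def Inv (π : Equiv.Perm (Fin n)) : Finset (Fin n × Fin n) :=
  Finset.univ.filter fun p => p.1 < p.2 ∧ π p.2 < π p.1

lemma mem_Inv (π : Equiv.Perm (Fin n)) (a b : Fin n) :
    (a, b) ∈ Inv π ↔ a < b ∧ π b < π a := by
  simp [Inv]

/-- Swap on naturals. -/
def sw (i x : ℕ) : ℕ := if x = i then i + 1 else if x = i + 1 then i else x

lemma sgen_val (i : Fin (n - 1)) (x : Fin n) : (sgen n i x : ℕ) = sw i x := by
  unfold sgen sw
  rw [Equiv.swap_apply_def]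
  simp only [Fin.ext_iff]
  split_ifs <;> rfl

lemma sgen_mul_self (i : Fin (n - 1)) : sgen n i * sgen n i = 1 := by
  simp [sgen]

lemma sgen_inv (i : Fin (n - 1)) : (sgen n i)⁻¹ = sgen n i := by
  simp [sgen]

lemma inv_le (i : Fin (n - 1)) (π : Equiv.Perm (Fin n)) :
    (Inv (sgen n i * π)).card ≤ (Inv π).card + 1 := by
  have hi := i.2
  let x : Fin n := π⁻¹ ⟨i.1, by omega⟩
  let y : Fin n := π⁻¹ ⟨i.1 + 1, by omega⟩
  have hx : ((π x : Fin n) : ℕ) = i := by simp [x]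
  have hy : ((π y : Fin n) : ℕ) = i + 1 := by simp [y]
  have : Inv (sgen n i * π) ⊆ insert (x, y) (Inv π) := by
    rintro ⟨a, b⟩ hab
    simp only [mem_Inv, Finset.mem_insert,
      Equiv.Perm.mul_apply, Prod.mk.injEq] at hab ⊢
    obtain ⟨h1, h2⟩ := hab
    by_cases h3 : π b < π a
    · exact Or.inr ⟨h1, h3⟩
    · left
      rw [Fin.lt_def, sgen_val, sgen_val] at h2
      have hne : ((π a : Fin n) : ℕ) ≠ π b := by
        intro h; exact h1.ne (π.injective (Fin.ext h))
      have h4 : ¬ ((π b : Fin n) : ℕ) < π a := h3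
      have : ((π a : Fin n) : ℕ) = i ∧ ((π b : Fin n) : ℕ) = i + 1 := by
        unfold sw at h2
        split_ifs at h2 <;> omega
      exact ⟨π.injective (Fin.ext (by omega)), π.injective (Fin.ext (by omega))⟩
  exact (Finset.card_le_card this).trans (Finset.card_insert_le _ _)

lemma inv_P_le (l : List (Fin (n - 1))) : (Inv (P n l)).card ≤ l.length := by
  induction l with
  | nil =>
    simp only [P_nil, List.length_nil, Nat.le_zero, Finset.card_eq_zero]
    ext ⟨a, b⟩
    simp [mem_Inv]
    intro h; exact h.le
  | cons i l ih =>
    rw [P_cons]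
    have := inv_le i (P n l)
    simp; omega

lemma inv_lt (i : Fin (n - 1)) (π : Equiv.Perm (Fin n))
    (h : π⁻¹ ⟨i.1, by have := i.2; omega⟩ < π⁻¹ ⟨i.1 + 1, by have := i.2; omega⟩) :
    (Inv π).card + 1 ≤ (Inv (sgen n i * π)).card := by
  have hi := i.2
  set x : Fin n := π⁻¹ ⟨i.1, by omega⟩ with hxd
  set y : Fin n := π⁻¹ ⟨i.1 + 1, by omega⟩ with hyd
  have hx : ((π x : Fin n) : ℕ) = i := by simp [x]
  have hy : ((π y : Fin n) : ℕ) = i + 1 := by simp [y]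
  have hn : (x, y) ∉ Inv π := by
    simp only [mem_Inv, not_and]
    intro _ h2
    rw [Fin.lt_def] at h2
    omega
  rw [← Finset.card_insert_of_notMem hn]
  apply Finset.card_le_card
  rintro ⟨a, b⟩ hab
  simp only [mem_Inv, Finset.mem_insert,
      Equiv.Perm.mul_apply, Prod.mk.injEq] at hab ⊢
  rcases hab with ⟨rfl, rfl⟩ | ⟨h1, h2⟩
  · refine ⟨h, ?_⟩
    rw [Fin.lt_def, sgen_val, sgen_val, hx, hy]
    simp [sw]
  · refine ⟨h1, ?_⟩
    rw [Fin.lt_def, sgen_val, sgen_val]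
    rw [Fin.lt_def] at h2
    have : ¬ (((π a : Fin n) : ℕ) = i + 1 ∧ ((π b : Fin n) : ℕ) = i) := by
      rintro ⟨ha, hb⟩
      have e1 : a = y := π.injective (Fin.ext (by omega))
      have e2 : b = x := π.injective (Fin.ext (by omega))
      subst e1 e2
      exact absurd h (not_lt.mpr h1.le)
    unfold sw
    split_ifs <;> omega

/-- Inverse action of a word. -/
def ev : List (Fin (n - 1)) → ℕ → ℕ
  | [], x => x
  | i :: l, x => ev l (sw i.1 x)

lemma ev_eq (l : List (Fin (n - 1))) (x : Fin n) : (((P n l)⁻¹ x : Fin n) : ℕ) = ev l x := by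
  induction l generalizing x with
  | nil => simp [P_nil, ev]
  | cons i l ih =>
    rw [P_cons, mul_inv_rev, Equiv.Perm.mul_apply, ih, sgen_inv, sgen_val]
    simp [ev]

/-- Inversion certificate of reducedness. -/
def Good (l : List (Fin (n - 1))) : Prop := l.length ≤ (Inv (P n l)).card

lemma Good.red {l : List (Fin (n - 1))} (h : Good l) : Red n l := by
  intro l' hl'
  have := inv_P_le l'
  rw [hl'] at this
  exact le_trans h this

lemma good_nil : Good ([] : List (Fin (n - 1))) := by simp [Good]

lemma good_cons {l : List (Fin (n - 1))} {i : Fin (n - 1)} (h : Good l)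
    (h2 : ev l i < ev l (i + 1)) : Good (i :: l) := by
  unfold Good at *
  rw [P_cons]
  have := inv_lt i (P n l) (by rw [Fin.lt_def, ev_eq, ev_eq]; exact h2)
  simp; omega

/-- Adjacent letters. -/
def Adj (i j : Fin (n - 1)) : Prop := (j : ℕ) = i + 1 ∨ (i : ℕ) = j + 1

lemma Adj.symm {i j : Fin (n - 1)} (h : Adj i j) : Adj j i := Or.symm h

lemma good1 {h j k : Fin (n - 1)} (hj : Adj h j) (h1 : k ≠ h) (h2 : k ≠ j) :
    Good [h, j, k] := by
  rw [Ne, Fin.ext_iff] at h1 h2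
  rcases hj with hj | hj <;>
  refine good_cons (good_cons (good_cons good_nil ?_) ?_) ?_ <;>
  simp only [ev, sw] <;> grind

lemma good2 {h j q : Fin (n - 1)} (hj : Adj h j) (hq : Adj q j) (h1 : q ≠ h) :
    Good [h, j, q, j] ∧ Good [j, h, q, j] := by
  rw [Ne, Fin.ext_iff] at h1
  obtain ⟨h, _⟩ := h
  obtain ⟨j, _⟩ := j
  obtain ⟨q, _⟩ := q
  simp only [Adj] at *
  rcases hj with hj | hj <;> rcases hq with hq | hq <;> first | omega | skip
  all_goals
    constructor <;>
    refine good_cons (good_cons (good_cons (good_cons good_nil ?_) ?_) ?_) ?_ <;>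
    simp only [ev, sw] <;> grind

lemma good3 {h j p : Fin (n - 1)} (hj : Adj h j) (hq : Adj p h) (h1 : p ≠ j) :
    Good [h, j, p, h] ∧ Good [j, h, p, h] := by
  have := good2 hj.symm hq h1
  exact ⟨this.2, this.1⟩

lemma good4 {h j q : Fin (n - 1)} (hj : Adj h j) (hq : Adj q j) (h1 : q ≠ h) :
    Good [h, j, q, j, h] ∧ Good [j, h, q, j, h] := by
  rw [Ne, Fin.ext_iff] at h1
  obtain ⟨h, _⟩ := h
  obtain ⟨j, _⟩ := j
  obtain ⟨q, _⟩ := q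
  simp only [Adj] at *
  rcases hj with hj | hj <;> rcases hq with hq | hq <;> first | omega | skip
  all_goals
    constructor <;>
    refine good_cons (good_cons (good_cons (good_cons (good_cons good_nil ?_) ?_) ?_) ?_) ?_ <;>
    simp only [ev, sw] <;> grind

lemma comm_of_not_adj {i j : Fin (n - 1)} (h : ¬ Adj i j) :
    sgen n i * sgen n j = sgen n j * sgen n i := by
  simp only [Adj, not_or] at h
  ext x
  simp only [Equiv.Perm.mul_apply, sgen_val, sw]
  split_ifs <;> omega

lemma braid {i j : Fin (n - 1)} (h : Adj i j) :
    sgen n i * sgen n j * sgen n i = sgen n j * sgen n i * sgen n j := by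
  ext x
  simp only [Equiv.Perm.mul_apply, sgen_val, sw]
  rcases h with h | h <;> grind

lemma sgen_ne {i j : Fin (n - 1)} (h : Adj i j) : sgen n i ≠ sgen n j := by
  intro he
  have hi := i.2
  have := congrArg (fun π : Equiv.Perm (Fin n) => ((π ⟨i.1, by omega⟩ : Fin n) : ℕ)) he
  simp only [sgen_val, sw] at this
  rcases h with h | h <;> split_ifs at this <;> omega

lemma sgen_mul_ne {i j : Fin (n - 1)} (h : Adj i j) :
    sgen n i * sgen n j ≠ sgen n j * sgen n i := by
  intro he
  have hb := braid h
  rw [he, mul_assoc, sgen_mul_self, mul_one, mul_assoc, he, ← mul_assoc, sgen_mul_self,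
    one_mul] at hb
  exact sgen_ne h hb.symm

lemma P_comm {s : Fin (n - 1)} {X : List (Fin (n - 1))} (h : ∀ p ∈ X, ¬ Adj p s) :
    sgen n s * P n X = P n X * sgen n s := by
  induction X with
  | nil => simp [P_nil]
  | cons i l ih =>
    simp only [List.mem_cons, forall_eq_or_imp] at h
    rw [P_cons, ← mul_assoc, ← comm_of_not_adj h.1, mul_assoc, ih h.2, mul_assoc]

lemma exists_adj {s : Fin (n - 1)} {X : List (Fin (n - 1))} (h : Red n (s :: X ++ [s])) :
    ∃ p ∈ X, Adj p s := by
  by_contra! hc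
  have := h X (by
    rw [List.cons_append, P_cons, P_append, P_cons, P_nil, mul_one, ← P_comm hc, ← mul_assoc,
      sgen_mul_self, one_mul])
  simp at this

lemma contra {h j : Fin (n - 1)} {A B C : List (Fin (n - 1))} (hj : Adj h j)
    (hA : ∀ p ∈ A, ¬ Adj p h) (hB : ∀ p ∈ B, ¬ Adj p h) (hB' : ∀ p ∈ B, ¬ Adj p j)
    (hC : ∀ p ∈ C, ¬ Adj p j)
    (hr : Red n (h :: A ++ j :: B ++ h :: C ++ [j])) : False := by
  have := hr (A ++ B ++ [j, h] ++ C) (by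
    simp only [List.cons_append, P_append, P_cons, P_nil, mul_one]
    have e1 := P_comm hA
    have e2 := P_comm hB
    have e3 := P_comm hB'
    have e4 := P_comm hC
    have e5 := braid hj
    calc P n A * P n B * (sgen n j * sgen n h) * P n C
        = P n A * P n B * (sgen n h * sgen n j * sgen n h * sgen n j) * P n C := by
          rw [e5, mul_assoc (sgen n j * sgen n h), sgen_mul_self, mul_one]
      _ = P n A * (P n B * sgen n h) * sgen n j * sgen n h * (sgen n j * P n C) := by group
      _ = P n A * (sgen n h * P n B) * sgen n j * sgen n h * (P n C * sgen n j) := by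
          rw [← e2, e4]
      _ = (P n A * sgen n h) * (P n B * sgen n j) * sgen n h * P n C * sgen n j := by group
      _ = (sgen n h * P n A) * (sgen n j * P n B) * sgen n h * P n C * sgen n j := by
          rw [← e1, e3]
      _ = _ := by group)
  simp at this

/-- The negated conclusion. -/
def Lat (n : ℕ) (k : Fin (n - 1)) (w : Equiv.Perm (Fin n)) : Prop :=
  ∀ x y : Equiv.Perm (Fin n),
        (BruhatLe n (sgen n k) x ∧ BruhatLe n x w) →
        (BruhatLe n (sgen n k) y ∧ BruhatLe n y w) →
        ((∃ s : Equiv.Perm (Fin n),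
            (BruhatLe n (sgen n k) s ∧ BruhatLe n s w) ∧
            BruhatLe n x s ∧ BruhatLe n y s ∧
            ∀ s' : Equiv.Perm (Fin n),
              (BruhatLe n (sgen n k) s' ∧ BruhatLe n s' w) →
              BruhatLe n x s' → BruhatLe n y s' → BruhatLe n s s') ∧
          ∃ m : Equiv.Perm (Fin n),
            (BruhatLe n (sgen n k) m ∧ BruhatLe n m w) ∧
            BruhatLe n m x ∧ BruhatLe n m y ∧
            ∀ m' : Equiv.Perm (Fin n),
              (BruhatLe n (sgen n k) m' ∧ BruhatLe n m' w) →
              BruhatLe n m' x → BruhatLe n m' y → BruhatLe n m' m)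

lemma le_of_sublist {l l' : List (Fin (n - 1))} (h : Red n l) (h' : Red n l')
    (hs : l.Sublist l') : BruhatLe n (P n l) (P n l') :=
  ⟨l', l, (red_iff l').2 h', (red_iff l).2 h, hs⟩

lemma le_of_equiv {l m l' : List (Fin (n - 1))} (h : Red n l) (h' : Red n l')
    (he : P n m = P n l) (hlen : m.length = l.length)
    (hs : m.Sublist l') : BruhatLe n (P n l) (P n l') := by
  rw [← he]
  refine le_of_sublist ?_ h' hs
  intro l'' hl''
  rw [hlen]
  exact h _ (hl''.trans he)

lemma exists_red (x : Equiv.Perm (Fin n)) {l : List (Fin (n - 1))} (hl : IsReducedWord n x l) :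
    P n l = x ∧ Red n l := ⟨hl.1, by obtain ⟨rfl, h⟩ := hl; exact h⟩

/-- Comparable elements: lengths are monotone, equality forces equality. -/
lemma le_len {x : Equiv.Perm (Fin n)} {l : List (Fin (n - 1))} (hl : Red n l)
    (h : BruhatLe n (P n l) x) : ∃ m, P n m = x ∧ Red n m ∧ l.length ≤ m.length ∧
      (l.length = m.length → x = P n l) := by
  obtain ⟨lw, lv, hw, hv, hs⟩ := h
  obtain ⟨e1, r1⟩ := exists_red _ hw
  obtain ⟨e2, r2⟩ := exists_red _ hv
  have h1 := hl lv e2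
  have h2 := r2 l e2.symm
  refine ⟨lw, e1, r1, h1.trans hs.length_le, fun h => ?_⟩
  rw [← e1, ← e2, hs.eq_of_length (by omega)]

lemma le_len' {x : Equiv.Perm (Fin n)} {l m : List (Fin (n - 1))} (hl : Red n l)
    (hm : Red n m) (hx : P n m = x)
    (h : BruhatLe n x (P n l)) : m.length ≤ l.length ∧
      (m.length = l.length → x = P n l) := by
  obtain ⟨lw, lv, hw, hv, hs⟩ := h
  obtain ⟨e1, r1⟩ := exists_red _ hw
  obtain ⟨e2, r2⟩ := exists_red _ hv
  subst hx
  have h1 := hm lv e2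
  have h2 := r2 m e2.symm
  have h3 := hl lw e1
  have h4 := r1 l e1.symm
  have := hs.length_le
  refine ⟨by omega, fun h => ?_⟩
  rw [← e1, ← e2, hs.eq_of_length (by omega)]

lemma butterfly {L u : List (Fin (n - 1))} {h j k : Fin (n - 1)} (hL : Red n L)
    (hj : Adj h j) (hk : k ∈ u) (g1 : Red n (h :: j :: u)) (g2 : Red n (j :: h :: u))
    (b1 : BruhatLe n (P n (h :: u)) (P n L)) (b2 : BruhatLe n (P n (j :: u)) (P n L))
    (b3 : BruhatLe n (P n (h :: j :: u)) (P n L))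
    (b4 : BruhatLe n (P n (j :: h :: u)) (P n L)) : ¬ Lat n k (P n L) := by
  intro H
  have g3 : Red n (j :: u) := Red.factor (a := [h]) (b := []) (by simpa using g1)
  have g4 : Red n (h :: u) := Red.factor (a := [j]) (b := []) (by simpa using g2)
  have gk : Red n [k] := by
    obtain ⟨s, t, rfl⟩ := List.append_of_mem hk
    exact Red.factor (a := h :: s) (b := t) (by simpa using g4)
  have ek : P n [k] = sgen n k := by simp [P]
  have hks : [k].Sublist u := by simpa using hk
  have k1 : ∀ l : List (Fin (n - 1)), Red n l → u.Sublist l → BruhatLe n (sgen n k) (P n l) := by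
    intro l hl hs
    rw [← ek]
    exact le_of_sublist gk hl (hks.trans hs)
  have s1 : u.Sublist (h :: u) := List.sublist_cons_self _ _
  have s2 : u.Sublist (j :: u) := List.sublist_cons_self _ _
  obtain ⟨⟨s, -, xs, ys, hs⟩, -⟩ := H (P n (h :: u)) (P n (j :: u)) ⟨k1 _ g4 s1, b1⟩ ⟨k1 _ g3 s2, b2⟩
  have t1 := hs (P n (h :: j :: u)) ⟨k1 _ g1 (s2.trans (List.sublist_cons_self _ _)), b3⟩
    (le_of_sublist g4 g1 (s2.cons_cons h)) (le_of_sublist g3 g1 (List.sublist_cons_self _ _))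
  have t2 := hs (P n (j :: h :: u)) ⟨k1 _ g2 (s1.trans (List.sublist_cons_self _ _)), b4⟩
    (le_of_sublist g4 g2 (List.sublist_cons_self _ _)) (le_of_sublist g3 g2 (s1.cons_cons j))
  obtain ⟨m, rfl, rm, l1, q1⟩ := le_len g4 xs
  obtain ⟨m', em, rm', l2, q2⟩ := le_len g3 ys
  have hmm : m'.length = m.length := le_antisymm (rm' _ em.symm) (rm _ em)
  obtain ⟨l3, q3⟩ := le_len' g1 rm rfl t1
  obtain ⟨l4, q4⟩ := le_len' g2 rm rfl t2
  simp only [List.length_cons] at *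
  rcases Nat.lt_or_ge (u.length + 1) m.length with hlt | hge
  · have e := (q3 (by omega)).symm.trans (q4 (by omega))
    simp only [P_cons, ← mul_assoc] at e
    exact sgen_mul_ne hj (mul_right_cancel e)
  · have e := (q1 (by omega)).symm.trans (q2 (by omega))
    simp only [P_cons] at e
    exact sgen_ne hj (mul_right_cancel e)

lemma butterfly' {L u : List (Fin (n - 1))} {h j k : Fin (n - 1)} (hL : Red n L)
    (hj : Adj h j) (hk : k ∈ u) (g1 : Good (h :: j :: u)) (g2 : Good (j :: h :: u))
    (hs : (h :: j :: h :: u).Sublist L) : ¬ Lat n k (P n L) := by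
  have g3 : Red n (j :: u) := Red.factor (a := [h]) (b := []) (by simpa using g1.red)
  have g4 : Red n (h :: u) := Red.factor (a := [j]) (b := []) (by simpa using g2.red)
  have hs2 : (j :: h :: u).Sublist L := (List.sublist_cons_self _ _).trans hs
  exact butterfly hL hj hk g1.red g2.red
    (le_of_sublist g4 hL ((List.sublist_cons_self _ _).trans hs2))
    (le_of_sublist g3 hL ((List.Sublist.cons_cons _ (List.sublist_cons_self _ _)).trans hs2))
    (le_of_sublist g1.red hL
      ((List.Sublist.cons_cons _ (List.Sublist.cons_cons _ (List.sublist_cons_self _ _))).trans hs))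
    (le_of_sublist g2.red hL hs2)

lemma butterfly'' {L u : List (Fin (n - 1))} {h j q k : Fin (n - 1)} (hL : Red n L)
    (hj : Adj h j) (hk : k ∈ q :: u) (g1 : Good (h :: j :: q :: u))
    (g2 : Good (j :: h :: q :: u)) (hq : ¬ Adj h q)
    (hs : (h :: j :: q :: h :: u).Sublist L) : ¬ Lat n k (P n L) := by
  have g3 : Red n (j :: q :: u) := Red.factor (a := [h]) (b := []) (by simpa using g1.red)
  have g4 : Red n (h :: q :: u) := Red.factor (a := [j]) (b := []) (by simpa using g2.red)
  have c1 : (q :: u).Sublist (q :: h :: u) := List.Sublist.cons_cons _ (List.sublist_cons_self _ _)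
  have c2 : (q :: h :: u).Sublist (j :: q :: h :: u) := List.sublist_cons_self _ _
  have hs2 : (j :: q :: h :: u).Sublist L := (List.sublist_cons_self _ _).trans hs
  refine butterfly hL hj hk g1.red g2.red
    (le_of_sublist g4 hL (((c1.trans c2).cons_cons h).trans hs))
    (le_of_sublist g3 hL ((c1.cons_cons j).trans hs2))
    (le_of_sublist g1.red hL (((c1.cons_cons j).cons_cons h).trans hs))
    (le_of_equiv (m := j :: q :: h :: u) g2.red hL ?_ (by simp) hs2)
  simp only [P_cons]
  rw [← mul_assoc (sgen n q), ← comm_of_not_adj hq, mul_assoc]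

lemma not_adj_of {h j q : Fin (n - 1)} (hj : Adj h j) (hq : Adj q j) : ¬ Adj h q := by
  simp only [Adj] at *
  omega

lemma adj_ne {h j : Fin (n - 1)} (hj : Adj h j) : h ≠ j := by
  rintro rfl
  simp only [Adj] at *
  omega

/-- pattern `h j h k`. -/
lemma pat1 {L : List (Fin (n - 1))} {h j k : Fin (n - 1)} (hL : Red n L) (H : Lat n k (P n L))
    (hj : Adj h j) (h1 : k ≠ h) (h2 : k ≠ j) : ¬ [h, j, h, k].Sublist L := fun hs =>
  butterfly' hL hj (by simp) (good1 hj h1 h2) (good1 hj.symm h2 h1) hs H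

lemma pat2 {L : List (Fin (n - 1))} {h j q : Fin (n - 1)} (hL : Red n L) (H : Lat n j (P n L))
    (hj : Adj h j) (hq : Adj q j) (h1 : q ≠ h) : ¬ [h, j, h, q, j].Sublist L := fun hs =>
  butterfly' hL hj (by simp) (good2 hj hq h1).1 (good2 hj hq h1).2 hs H

lemma pat2' {L : List (Fin (n - 1))} {h j q : Fin (n - 1)} (hL : Red n L) (H : Lat n j (P n L))
    (hj : Adj h j) (hq : Adj q j) (h1 : q ≠ h) : ¬ [h, j, q, h, j].Sublist L := fun hs =>
  butterfly'' hL hj (by simp) (good2 hj hq h1).1 (good2 hj hq h1).2 (not_adj_of hj hq) hs H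

lemma pat3 {L : List (Fin (n - 1))} {h j p : Fin (n - 1)} (hL : Red n L) (H : Lat n h (P n L))
    (hj : Adj h j) (hq : Adj p h) (h1 : p ≠ j) : ¬ [h, j, h, p, h].Sublist L := fun hs =>
  butterfly' hL hj (by simp) (good3 hj hq h1).1 (good3 hj hq h1).2 hs H

lemma pat4 {L : List (Fin (n - 1))} {h j q : Fin (n - 1)} (hL : Red n L) (H : Lat n h (P n L))
    (hj : Adj h j) (hq : Adj q j) (h1 : q ≠ h) : ¬ [h, j, h, q, j, h].Sublist L := fun hs =>
  butterfly' hL hj (by simp) (good4 hj hq h1).1 (good4 hj hq h1).2 hs H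

lemma pat4' {L : List (Fin (n - 1))} {h j q : Fin (n - 1)} (hL : Red n L) (H : Lat n h (P n L))
    (hj : Adj h j) (hq : Adj q j) (h1 : q ≠ h) : ¬ [h, j, q, h, j, h].Sublist L := fun hs =>
  butterfly'' hL hj (by simp) (good4 hj hq h1).1 (good4 hj hq h1).2 (not_adj_of hj hq) hs H

/-- split at the first occurrence -/
lemma split_first {x : Fin (n - 1)} {t L : List (Fin (n - 1))} (h : (x :: t).Sublist L) :
    ∃ A B, L = A ++ x :: B ∧ x ∉ A ∧ t.Sublist B := by
  have hx : x ∈ L := h.subset (by simp)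
  obtain ⟨A, B, rfl, hA⟩ := List.eq_append_cons_of_mem hx
  refine ⟨A, B, rfl, hA, ?_⟩
  clear hx
  induction A with
  | nil => simpa using h
  | cons a A ih =>
    simp only [List.mem_cons, not_or] at hA
    refine ih hA.2 ?_
    rw [List.cons_append] at h
    cases h with
    | cons _ h => exact h
    | cons_cons _ h => exact absurd rfl hA.1

lemma mem1 {p : Fin (n - 1)} {A : List (Fin (n - 1))} (h : p ∈ A) : [p].Sublist A := by
  simpa using h

lemma tail_sub {s t L D : List (Fin (n - 1))} (h : s.Sublist t) (hL : ∃ z, L = z ++ t ++ D) :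
    s.Sublist L := by
  obtain ⟨z, rfl⟩ := hL
  exact h.trans ((List.sublist_append_right _ _).trans (List.sublist_append_left _ _))

lemma case_j {L : List (Fin (n - 1))} {h j : Fin (n - 1)} (hL : Red n L) (H : Lat n j (P n L))
    (hj : Adj h j) (hs : [h, j, h, j].Sublist L) : False := by
  have hne := adj_ne hj
  obtain ⟨Z, L1, rfl, -, hs⟩ := split_first hs
  obtain ⟨A, L2, rfl, hA, hs⟩ := split_first hs
  obtain ⟨B, L3, rfl, hB, hs⟩ := split_first hs
  obtain ⟨C, D, rfl, hC, -⟩ := split_first hs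
  set L := Z ++ h :: (A ++ j :: (B ++ h :: (C ++ j :: D))) with hLdef
  have hLe : ∃ z, L = z ++ (h :: A ++ j :: B ++ h :: C ++ [j]) ++ D := ⟨Z, by simp [hLdef]⟩
  have hmain : Red n (h :: A ++ j :: B ++ h :: C ++ [j]) := by
    obtain ⟨z, hz⟩ := hLe
    rw [hz] at hL
    exact hL.factor
  -- sublists helper: choose sublists of each block
  have key : ∀ a b c : List (Fin (n - 1)), a.Sublist A → b.Sublist B → c.Sublist C →
      (h :: a ++ j :: b ++ h :: c ++ [j]).Sublist L := fun a b c ha hb hc =>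
    tail_sub ((((ha.cons_cons h).append (hb.cons_cons j)).append (hc.cons_cons h)).append
      (List.Sublist.refl _)) hLe
  have pA : ∀ p ∈ A, ¬ Adj p h := by
    intro p hp hadj
    have hpj : p ≠ j := fun e => hA (e ▸ hp)
    refine pat1 hL H hadj.symm hne.symm hpj.symm (List.Sublist.trans ?_
      (key [p] [] [] (mem1 hp) (by simp) (by simp)))
    simp
  have qB : ∀ q ∈ B, ¬ Adj q j := by
    intro q hq hadj
    have hqh : q ≠ h := fun e => hB (e ▸ hq)
    exact pat2' hL H hj hadj hqh (key [] [q] [] (by simp) (mem1 hq) (by simp))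
  have jB : j ∉ B := by
    intro hjB
    obtain ⟨B1, B2, rfl, -⟩ := List.eq_append_cons_of_mem hjB
    obtain ⟨q, hq, hadj⟩ := exists_adj (s := j) (X := B1)
      (Red.factor (a := h :: A) (b := B2 ++ h :: C ++ [j]) (by simpa using hmain))
    exact qB q (by simp [hq]) hadj
  have pB : ∀ p ∈ B, ¬ Adj p h := by
    intro p hp hadj
    have hpj : p ≠ j := fun e => jB (e ▸ hp)
    refine pat1 hL H hadj.symm hne.symm hpj.symm (List.Sublist.trans ?_
      (key [] [p] [] (by simp) (mem1 hp) (by simp)))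
    simp
  have hhC : h ∉ C := by
    intro hhC
    obtain ⟨C1, C2, rfl, -⟩ := List.eq_append_cons_of_mem hhC
    obtain ⟨p, hp, hadj⟩ := exists_adj (s := h) (X := C1)
      (Red.factor (a := h :: A ++ j :: B) (b := C2 ++ [j]) (by simpa using hmain))
    have hpj : p ≠ j := fun e => hC (e ▸ (by simp [hp]))
    have hsub : [p, h].Sublist (C1 ++ h :: C2) := (mem1 hp).append (mem1 (by simp))
    refine pat1 hL H hadj.symm hne.symm hpj.symm (List.Sublist.trans ?_
      (key [] [] [p, h] (by simp) (by simp) hsub))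
    exact List.sublist_append_right [h, j] _
  have qC : ∀ q ∈ C, ¬ Adj q j := by
    intro q hq hadj
    have hqh : q ≠ h := fun e => hhC (e ▸ hq)
    exact pat2 hL H hj hadj hqh (key [] [] [q] (by simp) (by simp) (mem1 hq))
  exact contra hj pA pB qB qC hmain

lemma case_h {L : List (Fin (n - 1))} {h j : Fin (n - 1)} (hL : Red n L) (H : Lat n h (P n L))
    (hj : Adj h j) (hs : [h, j, h, h].Sublist L) : False := by
  have hne := adj_ne hj
  obtain ⟨Z, L1, rfl, -, hs⟩ := split_first hs
  obtain ⟨A, L2, rfl, hA, hs⟩ := split_first hs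
  obtain ⟨B, L3, rfl, hB, hs⟩ := split_first hs
  obtain ⟨C, D, rfl, hC, -⟩ := split_first hs
  set L := Z ++ h :: (A ++ j :: (B ++ h :: (C ++ h :: D))) with hLdef
  have hLe : ∃ z, L = z ++ (h :: A ++ j :: B ++ h :: C ++ [h]) ++ D := ⟨Z, by simp [hLdef]⟩
  have hmain : Red n (h :: A ++ j :: B ++ h :: C ++ [h]) := by
    obtain ⟨z, hz⟩ := hLe
    rw [hz] at hL
    exact hL.factor
  have key : ∀ a b c : List (Fin (n - 1)), a.Sublist A → b.Sublist B → c.Sublist C →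
      (h :: a ++ j :: b ++ h :: c ++ [h]).Sublist L := fun a b c ha hb hc =>
    tail_sub ((((ha.cons_cons h).append (hb.cons_cons j)).append (hc.cons_cons h)).append
      (List.Sublist.refl _)) hLe
  have pC : ∀ p ∈ C, p ≠ j → ¬ Adj p h := by
    intro p hp hpj hadj
    exact pat3 hL H hj hadj hpj (key [] [] [p] (by simp) (by simp) (mem1 hp))
  have jC : j ∈ C := by
    obtain ⟨p, hp, hadj⟩ := exists_adj (s := h) (X := C)
      (Red.factor (a := h :: A ++ j :: B) (b := []) (by simpa using hmain))
    by_contra hjC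
    exact pC p hp (fun e => hjC (e ▸ hp)) hadj
  have pA : ∀ p ∈ A, ¬ Adj p h := by
    intro p hp hadj
    have hpj : p ≠ j := fun e => hA (e ▸ hp)
    refine pat3 hL H hadj.symm hj.symm hpj.symm (List.Sublist.trans ?_
      (key [p] [] [j] (mem1 hp) (by simp) (mem1 jC)))
    simp
  have qB : ∀ q ∈ B, ¬ Adj q j := by
    intro q hq hadj
    have hqh : q ≠ h := fun e => hB (e ▸ hq)
    exact pat4' hL H hj hadj hqh (key [] [q] [j] (by simp) (mem1 hq) (mem1 jC))
  have jB : j ∉ B := by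
    intro hjB
    obtain ⟨B1, B2, rfl, -⟩ := List.eq_append_cons_of_mem hjB
    obtain ⟨q, hq, hadj⟩ := exists_adj (s := j) (X := B1)
      (Red.factor (a := h :: A) (b := B2 ++ h :: C ++ [h]) (by simpa using hmain))
    exact qB q (by simp [hq]) hadj
  have pB : ∀ p ∈ B, ¬ Adj p h := by
    intro p hp hadj
    have hpj : p ≠ j := fun e => jB (e ▸ hp)
    refine pat3 hL H hadj.symm hj.symm hpj.symm (List.Sublist.trans ?_
      (key [] [p] [j] (by simp) (mem1 hp) (mem1 jC)))
    simp
  obtain ⟨C1, C2, hCe, hC1⟩ := List.eq_append_cons_of_mem jC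
  have qC : ∀ q ∈ C1, ¬ Adj q j := by
    intro q hq hadj
    have hqh : q ≠ h := fun e => hC (e ▸ (by simp [hCe, hq]))
    have hsub : [q, j].Sublist C := by
      rw [hCe]; exact (mem1 hq).append (mem1 (by simp))
    exact pat4 hL H hj hadj hqh (key [] [] [q, j] (by simp) (by simp) hsub)
  exact contra hj pA pB qB qC
    (Red.factor (a := []) (b := C2 ++ [h]) (by rw [hCe] at hmain; simpa using hmain))

end BruhatAux

/-- If some reduced word of `w ∈ S_n` has the form
`a σ_h b σ_{h+1} c σ_h d σ_k e`, then the Bruhat interval `[σ_k, w]` is not a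
lattice: it is not the case that every pair of elements of the interval has a
least upper bound and a greatest lower bound within the interval. -/
theorem interval_not_lattice_of_repeated_letter (n : ℕ) (w : Equiv.Perm (Fin n))
    (a b c d e : List (Fin (n - 1))) (h j k : Fin (n - 1))
    (hj : (j : ℕ) = (h : ℕ) + 1)
    (hred : IsReducedWord n w (a ++ h :: (b ++ j :: (c ++ h :: (d ++ k :: e))))) :
    ¬ ∀ x y : Equiv.Perm (Fin n),
        (BruhatLe n (sgen n k) x ∧ BruhatLe n x w) →
        (BruhatLe n (sgen n k) y ∧ BruhatLe n y w) →
        ((∃ s : Equiv.Perm (Fin n),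
            (BruhatLe n (sgen n k) s ∧ BruhatLe n s w) ∧
            BruhatLe n x s ∧ BruhatLe n y s ∧
            ∀ s' : Equiv.Perm (Fin n),
              (BruhatLe n (sgen n k) s' ∧ BruhatLe n s' w) →
              BruhatLe n x s' → BruhatLe n y s' → BruhatLe n s s') ∧
          ∃ m : Equiv.Perm (Fin n),
            (BruhatLe n (sgen n k) m ∧ BruhatLe n m w) ∧
            BruhatLe n m x ∧ BruhatLe n m y ∧
            ∀ m' : Equiv.Perm (Fin n),
              (BruhatLe n (sgen n k) m' ∧ BruhatLe n m' w) →
              BruhatLe n m' x → BruhatLe n m' y → BruhatLe n m' m) := by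
  intro H
  obtain ⟨rfl, hr⟩ := hred
  have hadj : BruhatAux.Adj h j := Or.inl hj
  set L := a ++ h :: (b ++ j :: (c ++ h :: (d ++ k :: e))) with hL
  have hsub : [h, j, h, k].Sublist L := by
    rw [hL]
    refine List.Sublist.trans ?_ (List.sublist_append_right _ _)
    refine List.Sublist.cons_cons _ (List.Sublist.trans ?_ (List.sublist_append_right _ _))
    refine List.Sublist.cons_cons _ (List.Sublist.trans ?_ (List.sublist_append_right _ _))
    refine List.Sublist.cons_cons _ (List.Sublist.trans ?_ (List.sublist_append_right _ _))
    simp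
  have hr' : BruhatAux.Red n L := hr
  have H' : BruhatAux.Lat n k (BruhatAux.P n L) := H
  by_cases h1 : k = h
  · subst h1
    exact BruhatAux.case_h hr' H' hadj hsub
  by_cases h2 : k = j
  · subst h2
    exact BruhatAux.case_j hr' H' hadj hsub
  exact BruhatAux.pat1 hr' H' hadj h1 h2 hsub
end

section
/- For fixed k with 1 ≤ k ≤ n-1, the number of permutations w ∈ S_n such that σ_k ≤_wk w and σ_k·w avoids the pattern 321 equals C_n − C_{n-1}, where C_i is the i-th Catalan number. In particular, this count does not depend on k. -/
/-- The adjacent transposition `σ_k = (k, k+1)` (1-indexed values `k`, `k+1`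
corresponding to the 0-indexed elements `k-1`, `k` of `Fin n`). -/
def sigk (n k : ℕ) (h : k < n) : Equiv.Perm (Fin n) :=
  Equiv.swap ⟨k - 1, by omega⟩ ⟨k, h⟩

/-- `σ_k ≤wk w` in the right weak order on `S_n`; equivalently,
`w⁻¹(k) > w⁻¹(k+1)` (1-indexed), i.e. 0-indexed `w⁻¹(k) < w⁻¹(k-1)`. -/
def WkAboveSigma (n k : ℕ) (h : k < n) (w : Equiv.Perm (Fin n)) : Prop :=
  w⁻¹ ⟨k, h⟩ < w⁻¹ ⟨k - 1, by omega⟩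

open Finset

namespace Cat321

/-- Extend a permutation by a new last entry `p`, relabelling the other values. -/
noncomputable def ext {n : ℕ} (p : Fin (n + 1)) (u : Equiv.Perm (Fin n)) : Equiv.Perm (Fin (n + 1)) :=
  Equiv.ofBijective (Fin.snoc (α := fun _ => Fin (n + 1)) (fun i => p.succAbove (u i)) p) (by
    rw [← Finite.injective_iff_bijective]
    intro a b
    refine Fin.lastCases ?_ (fun a => ?_) a <;> refine Fin.lastCases ?_ (fun b => ?_) b
    · simp
    · simp only [Fin.snoc_last, Fin.snoc_castSucc]
      intro h; exact absurd h.symm (Fin.succAbove_ne _ _)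
    · simp only [Fin.snoc_last, Fin.snoc_castSucc]
      intro h; exact absurd h (Fin.succAbove_ne _ _)
    · simp only [Fin.snoc_castSucc]
      intro h
      rw [u.injective (Fin.succAbove_right_injective h)])

@[simp] lemma ext_last {n : ℕ} (p : Fin (n + 1)) (u : Equiv.Perm (Fin n)) :
    ext p u (Fin.last n) = p := by simp [ext]

@[simp] lemma ext_castSucc {n : ℕ} (p : Fin (n + 1)) (u : Equiv.Perm (Fin n)) (i : Fin n) :
    ext p u i.castSucc = p.succAbove (u i) := by simp [ext]

lemma ext_bij (n : ℕ) : Function.Bijective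
    (fun x : Equiv.Perm (Fin n) × Fin (n + 1) => ext x.2 x.1) := by
  constructor
  · rintro ⟨u, p⟩ ⟨v, q⟩ h
    simp only at h
    have h1 : p = q := by
      have := congrArg (fun w => w (Fin.last n)) h
      simpa using this
    subst h1
    have h2 : u = v := by
      ext1 i
      have := congrArg (fun w => w i.castSucc) h
      simpa using this
    rw [h2]
  · intro w
    have h : ∀ i : Fin n, ∃ j, (w (Fin.last n)).succAbove j = w i.castSucc := by
      intro i
      apply Fin.exists_succAbove_eq
      intro h
      exact absurd (w.injective h) (Fin.castSucc_lt_last i).ne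
    choose f hf using h
    have hinj : Function.Injective f := by
      intro a b hab
      have : w a.castSucc = w b.castSucc := by rw [← hf, ← hf, hab]
      exact Fin.castSucc_injective _ (w.injective this)
    refine ⟨(Equiv.ofBijective f (Finite.injective_iff_bijective.mp hinj), w (Fin.last n)), ?_⟩
    ext1 i
    refine Fin.lastCases ?_ (fun a => ?_) i
    · simp
    · simp [hf]

lemma sum_ext {n : ℕ} (G : Equiv.Perm (Fin (n + 1)) → ℕ) :
    ∑ w, G w = ∑ u : Equiv.Perm (Fin n), ∑ p : Fin (n + 1), G (ext p u) := by
  rw [← Fintype.sum_prod_type' (fun u p => G (ext p u))]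
  exact ((ext_bij n).sum_comp G).symm

/-- One more than the largest bottom of an inversion (zero if there is none). -/
def thr {n : ℕ} (u : Equiv.Perm (Fin n)) : ℕ :=
  (univ.filter (fun x : Fin n × Fin n => x.1 < x.2 ∧ u x.2 < u x.1)).sup (fun x => (u x.2 : ℕ) + 1)

lemma thr_le {n : ℕ} (u : Equiv.Perm (Fin n)) (m : ℕ) :
    thr u ≤ m ↔ ∀ i j, i < j → u j < u i → (u j : ℕ) < m := by
  simp only [thr, Finset.sup_le_iff, mem_filter, mem_univ, true_and, Prod.forall, and_imp]
  rfl

lemma thr_le_self {n : ℕ} (u : Equiv.Perm (Fin n)) : thr u ≤ n :=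
  (thr_le u n).2 fun _ j _ _ => (u j).2

lemma succAbove_val {n : ℕ} (p : Fin (n + 1)) (a : Fin n) :
    ((p.succAbove a : Fin (n + 1)) : ℕ) = if (a : ℕ) < p then (a : ℕ) else a + 1 := by
  simp only [Fin.succAbove, Fin.lt_def, Fin.val_castSucc]
  split_ifs <;> simp

lemma succAbove_lt_pivot {n : ℕ} (p : Fin (n + 1)) (a : Fin n) :
    p < p.succAbove a ↔ (p : ℕ) ≤ a := by
  rw [Fin.lt_def, succAbove_val]; split_ifs <;> omega

lemma contains_ext {n : ℕ} (p : Fin (n + 1)) (u : Equiv.Perm (Fin n)) :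
    ¬ Contains321 (ext p u) ↔ ¬ Contains321 u ∧ thr u ≤ p := by
  rw [thr_le]
  constructor
  · intro h
    constructor
    · rintro ⟨i, j, k, h1, h2, h3, h4⟩
      exact h ⟨i.castSucc, j.castSucc, k.castSucc, by simpa, by simpa, by simpa, by simpa⟩
    · intro i j h1 h2
      by_contra h3
      exact h ⟨i.castSucc, j.castSucc, Fin.last n, by simpa, Fin.castSucc_lt_last _,
        by simpa [succAbove_lt_pivot] using h3, by simpa⟩
  · rintro ⟨h, h'⟩ ⟨i, j, k, h1, h2, h3, h4⟩
    obtain ⟨j, rfl⟩ := Fin.exists_castSucc_eq.2 (h2.trans_le (Fin.le_last k)).ne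
    obtain ⟨i, rfl⟩ := Fin.exists_castSucc_eq.2 (h1.trans (Fin.castSucc_lt_last j)).ne
    revert h2 h3
    refine Fin.lastCases ?_ (fun k => ?_) k
    · intro h2 h3
      have := h' i j (by simpa using h1) (by simpa using h4)
      simp only [ext_last, ext_castSucc, succAbove_lt_pivot] at h3
      omega
    · intro h2 h3
      exact h ⟨i, j, k, by simpa using h1, by simpa using h2, by simpa using h3, by simpa using h4⟩

lemma thr_ext {n : ℕ} (p : Fin (n + 1)) (u : Equiv.Perm (Fin n)) (h : thr u ≤ p) :
    thr (ext p u) = if (p : ℕ) = n then thr u else p + 1 := by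
  have hu := (thr_le u p).1 h
  have key : ∀ i j : Fin n, u j < u i → i < j → ((p.succAbove (u j) : Fin (n + 1)) : ℕ) = u j := by
    intro i j h1 h2
    rw [succAbove_val, if_pos (hu i j h2 h1)]
  apply eq_of_forall_ge_iff
  intro m
  split_ifs with hp
  · rw [thr_le, thr_le]
    constructor
    · intro H i j h1 h2
      have := H i.castSucc j.castSucc (by simpa) (by simpa)
      rwa [ext_castSucc, key i j h2 h1] at this
    · intro H i j h1 h2
      obtain ⟨i, rfl⟩ := Fin.exists_castSucc_eq.2 (h1.trans_le (Fin.le_last j)).ne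
      revert h1 h2
      refine Fin.lastCases ?_ (fun j => ?_) j
      · intro h1 h2
        simp only [ext_last, ext_castSucc, succAbove_lt_pivot] at h2
        omega
      · intro h1 h2
        have h1 : i < j := by simpa using h1
        have h2 : u j < u i := by simpa using h2
        rw [ext_castSucc, key i j h2 h1]
        exact H i j h1 h2
  · rw [thr_le]
    have hpn : (p : ℕ) < n := by omega
    constructor
    · intro H
      have := H (u.symm ⟨p, hpn⟩).castSucc (Fin.last n) (Fin.castSucc_lt_last _)
        (by simp [succAbove_lt_pivot])
      simpa using this
    · intro H i j h1 h2
      obtain ⟨i, rfl⟩ := Fin.exists_castSucc_eq.2 (h1.trans_le (Fin.le_last j)).ne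
      revert h1 h2
      refine Fin.lastCases ?_ (fun j => ?_) j
      · intro h1 h2
        simp only [ext_last]
        omega
      · intro h1 h2
        have h1 : i < j := by simpa using h1
        have h2 : u j < u i := by simpa using h2
        rw [ext_castSucc, key i j h2 h1]
        have := hu i j h1 h2
        omega

/-- The transfer operator of the Catalan generating tree. -/
def T (F : ℕ → ℕ) (s : ℕ) : ℕ := ∑ j ∈ range (s + 1), F (j + 1)

open Classical in
/-- Weighted count of 321-avoiding permutations satisfying `P`. -/
noncomputable def N (n : ℕ) (P : Equiv.Perm (Fin n) → Prop) (F : ℕ → ℕ) : ℕ :=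
  ∑ u : Equiv.Perm (Fin n), if P u ∧ ¬ Contains321 u then F (n - thr u) else 0

lemma sum_tail (t s : ℕ) (F : ℕ → ℕ) :
    ∑ p ∈ range (t + s), (if t ≤ p then F (t + s - p) else 0) = ∑ j ∈ range s, F (j + 1) := by
  rw [sum_range_add, sum_eq_zero, zero_add, ← sum_range_reflect (fun j => F (j + 1))]
  · apply sum_congr rfl
    intro x hx
    rw [mem_range] at hx
    rw [if_pos (by omega)]
    congr 1; omega
  · intro x hx
    rw [mem_range] at hx
    rw [if_neg (by omega)]

lemma inner_sum (n t : ℕ) (ht : t ≤ n) (F : ℕ → ℕ) :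
    ∑ p : Fin (n + 1), (if t ≤ (p : ℕ) then F (n + 1 - (if (p : ℕ) = n then t else p + 1)) else 0)
      = T F (n - t) := by
  obtain ⟨s, rfl⟩ := Nat.exists_eq_add_of_le ht
  rw [Fin.sum_univ_castSucc, T, add_tsub_cancel_left, sum_range_succ, ← sum_tail t s]
  rw [Finset.sum_range]
  congr 1
  · apply sum_congr rfl
    intro x _
    have := x.2
    simp only [Fin.val_castSucc]
    rw [if_neg (show ¬ ((x : ℕ) = t + s) by omega)]
    split_ifs
    · congr 1; omega
    · rfl
  · simp only [Fin.val_last, if_true]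
    rw [if_pos (by omega)]
    congr 1; omega

open Classical in
lemma N_succ (n : ℕ) (P : Equiv.Perm (Fin n) → Prop) (Q : Equiv.Perm (Fin (n + 1)) → Prop)
    (h : ∀ u p, Q (ext p u) ↔ P u) (F : ℕ → ℕ) : N (n + 1) Q F = N n P (T F) := by
  rw [N, N, sum_ext]
  apply sum_congr rfl
  intro u _
  simp only [h, contains_ext]
  split_ifs with hu
  · rw [← inner_sum n (thr u) (thr_le_self u)]
    apply sum_congr rfl
    intro p _
    by_cases hp : thr u ≤ p
    · rw [if_pos ⟨hu.1, hu.2, hp⟩, if_pos hp, thr_ext p u hp]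
    · rw [if_neg (by tauto), if_neg hp]
  · apply sum_eq_zero
    intro p _
    rw [if_neg (by tauto)]

/-- Descent at (0-indexed) positions `k-1, k`. -/
def D (k : ℕ) {n : ℕ} (u : Equiv.Perm (Fin n)) : Prop :=
  ∃ a b : Fin n, (a : ℕ) + 1 = k ∧ (b : ℕ) = k ∧ u b < u a

lemma D_ext (k n : ℕ) (hk : k < n) (u : Equiv.Perm (Fin n)) (p : Fin (n + 1)) :
    D k (ext p u) ↔ D k u := by
  constructor
  · rintro ⟨a, b, h1, h2, h3⟩
    obtain ⟨a, rfl⟩ := Fin.exists_castSucc_eq.2 (show a ≠ Fin.last n by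
      rintro rfl; simp at h1; omega)
    obtain ⟨b, rfl⟩ := Fin.exists_castSucc_eq.2 (show b ≠ Fin.last n by
      rintro rfl; simp at h2; omega)
    exact ⟨a, b, by simpa using h1, by simpa using h2, by simpa using h3⟩
  · rintro ⟨a, b, h1, h2, h3⟩
    exact ⟨a.castSucc, b.castSucc, by simpa, by simpa, by simpa⟩

lemma D_ext_ext (k : ℕ) (u : Equiv.Perm (Fin k)) (q : Fin (k + 1)) (p : Fin (k + 2)) :
    D (k + 1) (ext p (ext q u)) ↔ (p : ℕ) ≤ q := by
  constructor
  · rintro ⟨a, b, h1, h2, h3⟩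
    have ha : a = (Fin.last k).castSucc := by ext; simp; omega
    have hb : b = Fin.last (k + 1) := by ext; simp; omega
    subst ha hb
    simpa [succAbove_lt_pivot] using h3
  · intro h
    exact ⟨(Fin.last k).castSucc, Fin.last (k + 1), by simp, by simp,
      by simpa [succAbove_lt_pivot] using h⟩

open Classical in
lemma N_D_base (k : ℕ) (F : ℕ → ℕ) :
    N (k + 2) (D (k + 1)) F = N k (fun _ => True) (T F) := by
  rw [N, N, sum_ext, sum_ext]
  apply sum_congr rfl
  intro u _
  simp only [D_ext_ext, contains_ext, true_and]
  split_ifs with hu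
  · apply sum_eq_zero
    intro q _
    apply sum_eq_zero
    intro p _
    rw [if_neg (by tauto)]
  rw [Finset.sum_eq_single (Fin.last k)]
  · rw [Fin.sum_univ_castSucc, if_neg (by simp), add_zero]
    rw [T]
    have hle := thr_le_self u
    rw [show k - thr u + 1 = k + 1 - thr u by omega, ← sum_tail (thr u),
      show thr u + (k + 1 - thr u) = k + 1 by omega, Finset.sum_range]
    apply sum_congr rfl
    intro p _
    have hp := p.2
    have ht : thr (ext (Fin.last k) u) = thr u := by
      rw [thr_ext _ _ (by simpa using hle)]; simp
    by_cases hpt : thr u ≤ p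
    · rw [if_pos hpt, if_pos, thr_ext, if_neg]
      · simp
      · simp only [Fin.val_castSucc]; omega
      · simpa [ht] using hpt
      · refine ⟨?_, ⟨hu, ?_⟩, ?_⟩
        · simp; omega
        · simpa using hle
        · simpa [ht] using hpt
    · rw [if_neg hpt, if_neg]
      rintro ⟨_, _, h⟩
      rw [ht] at h
      exact hpt (by simpa using h)
  · intro q _ hq
    apply sum_eq_zero
    intro p _
    rw [if_neg]
    rintro ⟨h1, ⟨_, h2⟩, h3⟩
    have hq' : ¬ ((q : ℕ) = k) := fun h => hq (by ext; simpa using h)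
    rw [thr_ext q u h2, if_neg hq'] at h3
    omega
  · simp

lemma N_D (k m : ℕ) : ∀ F, N (k + 2 + m) (D (k + 1)) F = N (k + 1 + m) (fun _ => True) F := by
  induction m with
  | zero =>
    intro F
    rw [add_zero, add_zero, N_D_base, N_succ k (fun _ => True) (fun _ => True) (by simp)]
  | succ m ih =>
    intro F
    rw [← add_assoc, ← add_assoc, N_succ _ (D (k + 1)) (D (k + 1)) (fun u p => D_ext _ _ (by omega) u p),
      ih, N_succ (k + 1 + m) (fun _ => True) (fun _ => True) (by simp)]

lemma N_iter (n : ℕ) : ∀ F, N n (fun _ => True) F = (T^[n] F) 0 := by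
  induction n with
  | zero =>
    intro F
    have : ∀ u : Equiv.Perm (Fin 0), ¬ Contains321 u := by
      rintro u ⟨i, _⟩; exact i.elim0
    simp [N, this]
  | succ n ih =>
    intro F
    rw [N_succ n (fun _ => True) (fun _ => True) (by simp), ih, Function.iterate_succ_apply]

lemma T_zero (F : ℕ → ℕ) : T F 0 = F 1 := by simp [T]

lemma T_succ (F : ℕ → ℕ) (s : ℕ) : T F (s + 1) = T F s + F (s + 2) := by
  simp [T, sum_range_succ]

lemma iter_T (m : ℕ) : ∀ s,
    (T^[m + 1] (fun _ => 1)) s + (2 * (m + 1) + s).choose m = (2 * (m + 1) + s).choose (m + 1) := by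
  induction m with
  | zero => intro s; simp [T]; omega
  | succ m ih =>
    intro s
    induction s with
    | zero =>
      rw [Function.iterate_succ_apply', T_zero]
      have h1 := ih 1
      have e : 2 * (m + 1 + 1) + 0 = (2 * (m + 1) + 1) + 1 := by ring
      rw [e, Nat.choose_succ_succ (2 * (m + 1) + 1) m, Nat.choose_succ_succ (2 * (m + 1) + 1) (m + 1)]
      have h2 : (2 * (m + 1) + 1).choose (m + 1 + 1) = (2 * (m + 1) + 1).choose (m + 1) :=
        Nat.choose_symm_of_eq_add (by omega)
      simp only [Nat.succ_eq_add_one]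
      omega
    | succ s ihs =>
      rw [Function.iterate_succ_apply'] at ihs ⊢
      rw [T_succ]
      have h1 := ih (s + 2)
      have e : 2 * (m + 1 + 1) + (s + 1) = (2 * (m + 1 + 1) + s) + 1 := by ring
      have e2 : 2 * (m + 1) + (s + 2) = 2 * (m + 1 + 1) + s := by ring
      rw [e2] at h1
      rw [e, Nat.choose_succ_succ _ m, Nat.choose_succ_succ _ (m + 1)]
      simp only [Nat.succ_eq_add_one]
      omega

lemma N_catalan (n : ℕ) : N n (fun _ => True) (fun _ => 1) = catalan n := by
  rw [N_iter]
  cases n with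
  | zero => simp
  | succ m =>
    have h := iter_T m 0
    rw [add_zero] at h
    have h1 := succ_mul_catalan_eq_centralBinom (m + 1)
    rw [Nat.centralBinom_eq_two_mul_choose] at h1
    have h2 := Nat.choose_succ_right_eq (2 * (m + 1)) m
    rw [show 2 * (m + 1) - m = m + 2 by omega] at h2
    have : (m + 2) * (T^[m + 1] (fun _ => 1)) 0 = (m + 2) * catalan (m + 1) := by
      have h3 : (m + 2) * (T^[m + 1] (fun _ => 1)) 0 + (m + 2) * (2 * (m + 1)).choose m
        = (m + 2) * (2 * (m + 1)).choose (m + 1) := by rw [← h]; ring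
      have h1' : (m + 2) * catalan (m + 1) = (2 * (m + 1)).choose (m + 1) := h1
      nlinarith
    exact Nat.eq_of_mul_eq_mul_left (by omega) this

lemma contains_inv {n : ℕ} (u : Equiv.Perm (Fin n)) (h : Contains321 u) : Contains321 u⁻¹ := by
  obtain ⟨i, j, k, h1, h2, h3, h4⟩ := h
  exact ⟨u k, u j, u i, h3, h4, by simpa, by simpa⟩

lemma contains_inv_iff {n : ℕ} (u : Equiv.Perm (Fin n)) : Contains321 u⁻¹ ↔ Contains321 u :=
  ⟨fun h => by simpa using contains_inv _ h, contains_inv u⟩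

end Cat321

/-- For fixed `1 ≤ k ≤ n-1`, the number of `w ∈ S_n` with `σ_k ≤wk w` such that
`σ_k w` avoids `321` is `C_n - C_{n-1}`; in particular it does not depend on `k`. -/
theorem card_distributive_weak_intervals_over_sigma_k (n k : ℕ) (hk1 : 1 ≤ k)
    (hk2 : k ≤ n - 1) :
    Nat.card {w : Equiv.Perm (Fin n) // WkAboveSigma n k (by omega) w ∧
      ¬Contains321 (sigk n k (by omega) * w)} = catalan n - catalan (n - 1) := by
  classical
  have hkn : k < n := by omega
  have hD : Cat321.N n (Cat321.D k) (fun _ => 1) = catalan (n - 1) := by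
    obtain ⟨k, rfl⟩ : ∃ j, k = j + 1 := ⟨k - 1, by omega⟩
    obtain ⟨m, rfl⟩ : ∃ m, n = k + 2 + m := ⟨n - (k + 2), by omega⟩
    rw [Cat321.N_D, Cat321.N_catalan]
    congr 1; omega
  have hA : Nat.card {w : Equiv.Perm (Fin n) // WkAboveSigma n k hkn w ∧
      ¬Contains321 (sigk n k hkn * w)} = Cat321.N n (fun u => ¬ Cat321.D k u) (fun _ => 1) := by
    have hN : Cat321.N n (fun u => ¬ Cat321.D k u) (fun _ => 1) =
        Nat.card {u : Equiv.Perm (Fin n) // ¬ Cat321.D k u ∧ ¬ Contains321 u} := by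
      rw [Nat.card_eq_fintype_card, Fintype.card_subtype, Finset.card_filter, Cat321.N]
      apply Finset.sum_congr rfl
      intro u _
      congr
    rw [hN]
    refine Nat.card_congr (Equiv.subtypeEquiv
      ((Equiv.mulLeft (sigk n k hkn)).trans (Equiv.inv _)) ?_)
    intro w
    have e : ((Equiv.mulLeft (sigk n k hkn)).trans (Equiv.inv _)) w = (sigk n k hkn * w)⁻¹ := rfl
    rw [e, Cat321.contains_inv_iff]
    refine and_congr_left fun _ => ?_
    have hs1 : (sigk n k hkn * w)⁻¹ ⟨k - 1, by omega⟩ = w⁻¹ ⟨k, hkn⟩ := by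
      simp [mul_inv_rev, sigk]
    have hs2 : (sigk n k hkn * w)⁻¹ ⟨k, hkn⟩ = w⁻¹ ⟨k - 1, by omega⟩ := by
      simp [mul_inv_rev, sigk]
    have hd : Cat321.D k (sigk n k hkn * w)⁻¹ ↔ w⁻¹ ⟨k - 1, by omega⟩ < w⁻¹ ⟨k, hkn⟩ := by
      rw [← hs1, ← hs2]
      constructor
      · rintro ⟨a, b, h1, h2, h3⟩
        have ha : a = ⟨k - 1, by omega⟩ := by ext; simp; omega
        have hb : b = ⟨k, hkn⟩ := by ext; simp; omega
        rwa [hb, ha] at h3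
      · intro h
        exact ⟨_, _, by simp; omega, rfl, h⟩
    rw [hd, WkAboveSigma, not_lt]
    refine ⟨le_of_lt, fun h => lt_of_le_of_ne h fun h' => ?_⟩
    have := congrArg Fin.val (w⁻¹.injective h')
    simp at this
    omega
  have hsum : Cat321.N n (fun u => ¬ Cat321.D k u) (fun _ => 1) + Cat321.N n (Cat321.D k) (fun _ => 1)
      = catalan n := by
    rw [← Cat321.N_catalan n, Cat321.N, Cat321.N, Cat321.N, ← Finset.sum_add_distrib]
    apply Finset.sum_congr rfl
    intro u _
    by_cases h1 : Cat321.D k u <;> by_cases h2 : Contains321 u <;> simp [h1, h2]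
  rw [hA]
  omega
end
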